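/- Let 𝒜 be a finite affine hyperplane arrangement in ℝ^d and ρ : (Θ,∼_Θ) → (Γ(𝒜),∼) a cover of oriented systems with Θ connected. For each codimension-2 face F ∈ 𝓕(𝒜) and each vertex v of Θ with F > ρ(v), let β₁(F,v) and β₂(F,v) be the lifts at v of the two positive minimal paths of Γ(𝒜) from ρ(v) to the chamber opposite to ρ(v) with respect to F all of whose vertices are chambers C with F > C. Then the normal subgroup of π₁(Θ) generated by the classes of the loops β₁(F,v)·β₂(F,v)⁻¹, over all such pairs (F,v), equals Σ_ρ, the normal subgroup of π₁(Θ) generated by the classes of all loops γ₁γ₂⁻¹ where γ₁, γ₂ are paths of Θ with common begin and end and ρ(γ₁) ∼ ρ(γ₂). -/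

import Mathlib

open CategoryTheory

attribute [local instance] Classical.propDecidable

noncomputable section

/-! ### Hyperplane arrangements -/

/-- `H` is an affine hyperplane in `ℝ^d`. -/
def IsHyperplane {d : ℕ} (H : Set (Fin d → ℝ)) : Prop :=
  ∃ (a : Fin d → ℝ) (b : ℝ), a ≠ 0 ∧ H = {x | ∑ i, a i * x i = b}

/-- A finite affine hyperplane arrangement. -/
def IsArrangement {d : ℕ} (𝒜 : Finset (Set (Fin d → ℝ))) : Prop :=
  ∀ H ∈ 𝒜, IsHyperplane H

/-- The union of the hyperplanes of the arrangement. -/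
def ArrUnion {d : ℕ} (𝒜 : Finset (Set (Fin d → ℝ))) : Set (Fin d → ℝ) :=
  ⋃ H ∈ 𝒜, (H : Set (Fin d → ℝ))

/-- `x` and `y` lie on the same side of `H` (same connected component of the complement). -/
def SameSide {d : ℕ} (H : Set (Fin d → ℝ)) (x y : Fin d → ℝ) : Prop :=
  connectedComponentIn Hᶜ x = connectedComponentIn Hᶜ y

/-- The (relatively open) stratum of the point `x`: all points lying on exactly the same
hyperplanes as `x` and on the same side of all other hyperplanes. -/
def faceOf {d : ℕ} (𝒜 : Finset (Set (Fin d → ℝ))) (x : Fin d → ℝ) : Set (Fin d → ℝ) :=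
  {y | ∀ H ∈ 𝒜, (x ∈ H ↔ y ∈ H) ∧ (x ∉ H → SameSide H x y)}

/-- The faces of the arrangement: the relatively open strata of the stratification of `ℝ^d`
induced by `𝒜`. -/
def Faces {d : ℕ} (𝒜 : Finset (Set (Fin d → ℝ))) : Set (Set (Fin d → ℝ)) :=
  {F | ∃ x, F = faceOf 𝒜 x}

/-- A chamber: a connected component of the complement of the arrangement. -/
def IsChamber {d : ℕ} (𝒜 : Finset (Set (Fin d → ℝ))) (C : Set (Fin d → ℝ)) : Prop :=
  ∃ x, x ∉ ArrUnion 𝒜 ∧ C = connectedComponentIn (ArrUnion 𝒜)ᶜ x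

/-- The order of the face poset: `F₁ ≥ F₂` iff `closure F₁ ⊆ closure F₂`. -/
def FaceGE {d : ℕ} (F₁ F₂ : Set (Fin d → ℝ)) : Prop :=
  closure F₁ ⊆ closure F₂

/-- Strict version of the face-poset order. -/
def FaceGT {d : ℕ} (F₁ F₂ : Set (Fin d → ℝ)) : Prop :=
  FaceGE F₁ F₂ ∧ F₁ ≠ F₂

/-- The characterizing property of the composition `F ∘ P` of two faces: `Q` contains all
points `x + ε (y - x)`, for `x ∈ F`, `y ∈ P` and all sufficiently small `ε > 0`. -/
def CompProp {d : ℕ} (F P Q : Set (Fin d → ℝ)) : Prop :=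
  ∀ x ∈ F, ∀ y ∈ P, ∃ ε₀ > (0 : ℝ), ∀ ε : ℝ, 0 < ε → ε < ε₀ → x + ε • (y - x) ∈ Q

/-- The composition `F ∘ P` of two faces: the unique face `Q` satisfying `CompProp F P Q`
(junk value `∅` if no unique such face exists). -/
def faceComp {d : ℕ} (𝒜 : Finset (Set (Fin d → ℝ))) (F P : Set (Fin d → ℝ)) :
    Set (Fin d → ℝ) :=
  if h : ∃! Q, Q ∈ Faces 𝒜 ∧ CompProp F P Q then h.choose else ∅

/-- `H` separates the (chambers) `A` and `B`. -/
def Separates {d : ℕ} (H A B : Set (Fin d → ℝ)) : Prop :=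
  ∃ x ∈ A, ∃ y ∈ B, x ∉ H ∧ y ∉ H ∧ ¬ SameSide H x y

/-- Two chambers are adjacent if exactly one hyperplane of `𝒜` separates them. -/
def Adjacent {d : ℕ} (𝒜 : Finset (Set (Fin d → ℝ))) (A B : Set (Fin d → ℝ)) : Prop :=
  ∃! H, H ∈ 𝒜 ∧ Separates H A B

/-! ### Oriented graphs and walks -/

/-- An oriented graph: vertices, edges, source and target maps. -/
structure OrientedGraph : Type 1 where
  V : Type
  E : Type
  src : E → V
  tgt : E → V

namespace OrientedGraph

variable (G : OrientedGraph)

/-- Start vertex of a signed edge (an edge traversed forwards (`true`) or backwards). -/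
def stepSrc : G.E × Bool → G.V
  | (e, true) => G.src e
  | (e, false) => G.tgt e

/-- End vertex of a signed edge. -/
def stepTgt : G.E × Bool → G.V
  | (e, true) => G.tgt e
  | (e, false) => G.src e

/-- The list of signed edges `l` forms a walk starting at `v`. -/
def WalkFrom : G.V → List (G.E × Bool) → Prop
  | _, [] => True
  | v, s :: l => G.stepSrc s = v ∧ WalkFrom (G.stepTgt s) l

/-- The final vertex of a walk. -/
def walkEnd : G.V → List (G.E × Bool) → G.V
  | v, [] => v
  | _, s :: l => walkEnd (G.stepTgt s) l

/-- The list of vertices visited by a walk. -/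
def visits : G.V → List (G.E × Bool) → List G.V
  | v, [] => [v]
  | v, s :: l => v :: visits (G.stepTgt s) l

theorem walkEnd_append : ∀ (l₁ l₂ : List (G.E × Bool)) (v : G.V),
    G.walkEnd v (l₁ ++ l₂) = G.walkEnd (G.walkEnd v l₁) l₂
  | [], _, _ => rfl
  | s :: l₁, l₂, _ => walkEnd_append l₁ l₂ (G.stepTgt s)

theorem walkFrom_append : ∀ (l₁ l₂ : List (G.E × Bool)) (v : G.V),
    G.WalkFrom v l₁ → G.WalkFrom (G.walkEnd v l₁) l₂ → G.WalkFrom v (l₁ ++ l₂)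
  | [], _, _, _, h₂ => h₂
  | _ :: l₁, l₂, _, h₁, h₂ => ⟨h₁.1, walkFrom_append l₁ l₂ _ h₁.2 h₂⟩

/-- Reversal of a signed edge. -/
def flipStep (s : G.E × Bool) : G.E × Bool := (s.1, !s.2)

theorem stepSrc_flip (s : G.E × Bool) : G.stepSrc (G.flipStep s) = G.stepTgt s := by
  rcases s with ⟨e, _ | _⟩ <;> rfl

theorem stepTgt_flip (s : G.E × Bool) : G.stepTgt (G.flipStep s) = G.stepSrc s := by
  rcases s with ⟨e, _ | _⟩ <;> rfl

/-- The list of signed edges of the inverse walk. -/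
def invList (l : List (G.E × Bool)) : List (G.E × Bool) := (l.map G.flipStep).reverse

theorem invList_cons (s : G.E × Bool) (l : List (G.E × Bool)) :
    G.invList (s :: l) = G.invList l ++ [G.flipStep s] := by
  simp [invList]

theorem walkEnd_inv : ∀ (l : List (G.E × Bool)) (v : G.V), G.WalkFrom v l →
    G.walkEnd (G.walkEnd v l) (G.invList l) = v
  | [], _, _ => rfl
  | s :: l, v, h => by
      rw [show G.walkEnd v (s :: l) = G.walkEnd (G.stepTgt s) l from rfl,
        G.invList_cons, G.walkEnd_append, walkEnd_inv l _ h.2]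
      show G.stepTgt (G.flipStep s) = v
      rw [G.stepTgt_flip]; exact h.1

theorem walkFrom_inv : ∀ (l : List (G.E × Bool)) (v : G.V), G.WalkFrom v l →
    G.WalkFrom (G.walkEnd v l) (G.invList l)
  | [], _, _ => trivial
  | s :: l, v, h => by
      rw [show G.walkEnd v (s :: l) = G.walkEnd (G.stepTgt s) l from rfl, G.invList_cons]
      refine G.walkFrom_append _ _ _ (walkFrom_inv l _ h.2) ?_
      rw [G.walkEnd_inv l _ h.2]
      exact ⟨G.stepSrc_flip s, trivial⟩

end OrientedGraph

/-- A walk in an oriented graph: a start vertex and a composable list of signed edges. -/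
structure GWalk (G : OrientedGraph) where
  start : G.V
  steps : List (G.E × Bool)
  valid : G.WalkFrom start steps

namespace GWalk

variable {G : OrientedGraph}

/-- The end vertex of a walk. -/
def endV (w : GWalk G) : G.V := G.walkEnd w.start w.steps

/-- The length of a walk. -/
def length (w : GWalk G) : ℕ := w.steps.length

/-- A walk is positive if all its edges are traversed forwards. -/
def Positive (w : GWalk G) : Prop := ∀ s ∈ w.steps, s.2 = true

/-- The vertices visited by a walk. -/
def vertices (w : GWalk G) : List G.V := G.visits w.start w.steps

/-- The constant walk at a vertex. -/
def nil (G : OrientedGraph) (v : G.V) : GWalk G := ⟨v, [], trivial⟩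

/-- Concatenation of walks (junk value `w₁` if the endpoints do not match). -/
def append' (w₁ w₂ : GWalk G) : GWalk G :=
  if h : w₁.endV = w₂.start then
    ⟨w₁.start, w₁.steps ++ w₂.steps,
      G.walkFrom_append _ _ _ w₁.valid
        (by rw [show G.walkEnd w₁.start w₁.steps = w₂.start from h]; exact w₂.valid)⟩
  else w₁

/-- The inverse walk. -/
def inv (w : GWalk G) : GWalk G := ⟨w.endV, G.invList w.steps, G.walkFrom_inv _ _ w.valid⟩

end GWalk

/-- A morphism of oriented graphs. -/
structure GraphMor (G H : OrientedGraph) where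
  onV : G.V → H.V
  onE : G.E → H.E
  src_comm : ∀ e, H.src (onE e) = onV (G.src e)
  tgt_comm : ∀ e, H.tgt (onE e) = onV (G.tgt e)

namespace GraphMor

variable {G H : OrientedGraph} (ρ : GraphMor G H)

/-- Image of a signed edge. -/
def mapStep (s : G.E × Bool) : H.E × Bool := (ρ.onE s.1, s.2)

theorem stepSrc_map (s : G.E × Bool) :
    H.stepSrc (ρ.mapStep s) = ρ.onV (G.stepSrc s) := by
  rcases s with ⟨e, _ | _⟩
  · exact ρ.tgt_comm e
  · exact ρ.src_comm e

theorem stepTgt_map (s : G.E × Bool) :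
    H.stepTgt (ρ.mapStep s) = ρ.onV (G.stepTgt s) := by
  rcases s with ⟨e, _ | _⟩
  · exact ρ.src_comm e
  · exact ρ.tgt_comm e

theorem walkFrom_map : ∀ (l : List (G.E × Bool)) (v : G.V),
    G.WalkFrom v l → H.WalkFrom (ρ.onV v) (l.map ρ.mapStep)
  | [], _, _ => trivial
  | s :: l, v, h => by
      refine ⟨?_, ?_⟩
      · rw [ρ.stepSrc_map, h.1]
      · rw [ρ.stepTgt_map]
        exact walkFrom_map l _ h.2

theorem walkEnd_map : ∀ (l : List (G.E × Bool)) (v : G.V),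
    H.walkEnd (ρ.onV v) (l.map ρ.mapStep) = ρ.onV (G.walkEnd v l)
  | [], _ => rfl
  | s :: l, v => by
      show H.walkEnd (H.stepTgt (ρ.mapStep s)) (l.map ρ.mapStep) = _
      rw [ρ.stepTgt_map]
      exact walkEnd_map l _

/-- Image of a walk under a morphism of oriented graphs. -/
def mapWalk (w : GWalk G) : GWalk H :=
  ⟨ρ.onV w.start, w.steps.map ρ.mapStep, ρ.walkFrom_map _ _ w.valid⟩

theorem mapWalk_start (w : GWalk G) : (ρ.mapWalk w).start = ρ.onV w.start := rfl

theorem mapWalk_endV (w : GWalk G) : (ρ.mapWalk w).endV = ρ.onV w.endV :=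
  ρ.walkEnd_map _ _

end GraphMor

/-- A positive walk of minimal length among the positive walks with the same endpoints. -/
def IsMinPos (G : OrientedGraph) (w : GWalk G) : Prop :=
  w.Positive ∧ ∀ w' : GWalk G, w'.start = w.start → w'.endV = w.endV → w'.Positive →
    w.length ≤ w'.length

/-- An oriented system: an oriented graph together with an equivalence relation on its
walks which is endpoint-preserving, cancellative and compatible with composition. -/
structure OrientedSystem (G : OrientedGraph) where
  rel : GWalk G → GWalk G → Prop
  rel_start : ∀ {α β}, rel α β → α.start = β.start
  rel_endV : ∀ {α β}, rel α β → α.endV = β.endV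
  rel_refl : ∀ α, rel α α
  rel_symm : ∀ {α β}, rel α β → rel β α
  rel_trans : ∀ {α β γ}, rel α β → rel β γ → rel α γ
  rel_cancel : ∀ α : GWalk G, rel (α.append' α.inv) (GWalk.nil G α.start)
  rel_inv : ∀ {α β}, rel α β → rel α.inv β.inv
  rel_comp : ∀ {α β : GWalk G} (γ₁ γ₂ : GWalk G), rel α β →
      γ₁.endV = α.start → α.endV = γ₂.start →
      rel ((γ₁.append' α).append' γ₂) ((γ₁.append' β).append' γ₂)

/-- The oriented system of an arrangement: the smallest oriented-system relation
identifying any two positive minimal walks with the same begin and end. -/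
def IsMinimalSystem (G : OrientedGraph) (S : OrientedSystem G) : Prop :=
  (∀ α β : GWalk G, α.start = β.start → α.endV = β.endV →
      IsMinPos G α → IsMinPos G β → S.rel α β) ∧
  ∀ S' : OrientedSystem G,
    (∀ α β : GWalk G, α.start = β.start → α.endV = β.endV →
        IsMinPos G α → IsMinPos G β → S'.rel α β) →
    ∀ α β, S.rel α β → S'.rel α β

/-- A cover of oriented systems: unique path lifting, preserving the identifications. -/
structure IsCoverOS {Θ Γ : OrientedGraph} (ρ : GraphMor Θ Γ)
    (SΘ : OrientedSystem Θ) (SΓ : OrientedSystem Γ) : Prop where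
  lift_exists_unique : ∀ (v : Θ.V) (α : GWalk Γ), α.start = ρ.onV v →
    ∃! α' : GWalk Θ, α'.start = v ∧ ρ.mapWalk α' = α
  lift_rel : ∀ (v : Θ.V) (α β : GWalk Γ), α.start = ρ.onV v → β.start = ρ.onV v →
    SΓ.rel α β → ∀ α' β' : GWalk Θ, α'.start = v → β'.start = v →
    ρ.mapWalk α' = α → ρ.mapWalk β' = β → SΘ.rel α' β'

/-- A connected oriented graph. -/
def GConnected (G : OrientedGraph) : Prop :=
  Nonempty G.V ∧ ∀ a b : G.V, ∃ w : GWalk G, w.start = a ∧ w.endV = b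

/-! ### The graph of chambers of an arrangement -/

/-- The oriented graph `Γ(𝒜)`: vertices are the chambers, with a directed edge in each
direction between each pair of adjacent chambers. -/
def chamberGraph {d : ℕ} (𝒜 : Finset (Set (Fin d → ℝ))) : OrientedGraph where
  V := {C : Set (Fin d → ℝ) // IsChamber 𝒜 C}
  E := {p : {C : Set (Fin d → ℝ) // IsChamber 𝒜 C} × {C : Set (Fin d → ℝ) // IsChamber 𝒜 C} //
    Adjacent 𝒜 p.1.1 p.2.1}
  src := fun e => e.1.1
  tgt := fun e => e.1.2

/-- The end vertex of the lift at `v` of a positive minimal walk from `ρ(v)` to `b`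
(junk value `v` if no such lift exists). -/
def liftEnd {d : ℕ} {𝒜 : Finset (Set (Fin d → ℝ))} {Θ : OrientedGraph}
    (ρ : GraphMor Θ (chamberGraph 𝒜)) (v : Θ.V) (b : (chamberGraph 𝒜).V) : Θ.V :=
  if h : ∃ γ : GWalk Θ, γ.start = v ∧ IsMinPos (chamberGraph 𝒜) (ρ.mapWalk γ) ∧
      (ρ.mapWalk γ).endV = b then
    h.choose.endV
  else v

/-! ### The poset limits of the diagrams -/

/-- Elements of the poset limit `Plim 𝒟_id`: pairs `(F, C)` with `F` a face, `C` a chamber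
and `F > C`. -/
def PlimIdMem {d : ℕ} (𝒜 : Finset (Set (Fin d → ℝ)))
    (p : Set (Fin d → ℝ) × Set (Fin d → ℝ)) : Prop :=
  p.1 ∈ Faces 𝒜 ∧ IsChamber 𝒜 p.2 ∧ FaceGT p.1 p.2

/-- The order of the poset limit `Plim 𝒟_id`:
`(F₁, C₁) ≥ (F₂, C₂)` iff `F₁ ≥ F₂` and `C₂ = (C₁)_{F₂}` (with `C₂ = C₁` when `F₁ = F₂`). -/
def PlimIdGE {d : ℕ} (𝒜 : Finset (Set (Fin d → ℝ)))
    (p q : Set (Fin d → ℝ) × Set (Fin d → ℝ)) : Prop :=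
  FaceGE p.1 q.1 ∧
    ((p.1 = q.1 ∧ p.2 = q.2) ∨ (p.1 ≠ q.1 ∧ q.2 = faceComp 𝒜 q.1 p.2))

/-- Elements of the poset limit `Plim 𝒟_ρ`: pairs `(F, v)` with `F` a face, `v` a vertex
of `Θ` and `F > ρ(v)`. -/
def PlimRhoMem {d : ℕ} (𝒜 : Finset (Set (Fin d → ℝ))) {Θ : OrientedGraph}
    (ρ : GraphMor Θ (chamberGraph 𝒜)) (p : Set (Fin d → ℝ) × Θ.V) : Prop :=
  p.1 ∈ Faces 𝒜 ∧ FaceGT p.1 (ρ.onV p.2).1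

/-- The order of the poset limit `Plim 𝒟_ρ`: `(F₁, v₁) ≥ (F₂, v₂)` iff `F₁ ≥ F₂` and
`v₂ = end(γ̂_{v₁}(ρ(v₁) → ρ(v₁)_{F₂}))` (with `v₂ = v₁` when `F₁ = F₂`). -/
def PlimRhoGE {d : ℕ} (𝒜 : Finset (Set (Fin d → ℝ))) {Θ : OrientedGraph}
    (ρ : GraphMor Θ (chamberGraph 𝒜)) (p q : Set (Fin d → ℝ) × Θ.V) : Prop :=
  FaceGE p.1 q.1 ∧
    ((p.1 = q.1 ∧ p.2 = q.2) ∨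
      (p.1 ≠ q.1 ∧ ∃ h : IsChamber 𝒜 (faceComp 𝒜 q.1 (ρ.onV p.2).1),
        q.2 = liftEnd ρ p.2 ⟨faceComp 𝒜 q.1 (ρ.onV p.2).1, h⟩))

/-! ### Geometric realization of order complexes -/

/-- The geometric realization of the order complex of the relation `r` on the set of
elements satisfying `S`: convex combinations (in `P → ℝ`, with the product topology)
whose supports are finite chains of elements satisfying `S`. -/
def ocg {P : Type} (S : P → Prop) (r : P → P → Prop) : Set (P → ℝ) :=
  {f | (∀ p, 0 ≤ f p) ∧
       (∃ s : Finset P, (∀ p ∉ s, f p = 0) ∧ ∑ p ∈ s, f p = 1) ∧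
       (∀ p, f p ≠ 0 → S p) ∧
       IsChain r {p | f p ≠ 0}}

/-- The vertex of the realization of an order complex corresponding to `p₀`. -/
def vtx {P : Type} (p₀ : P) : P → ℝ := fun p => if p = p₀ then 1 else 0

theorem vtx_mem {P : Type} {S : P → Prop} {r : P → P → Prop} {p₀ : P} (h : S p₀) :
    vtx p₀ ∈ ocg S r := by
  have hsupp : ∀ p : P, vtx p₀ p ≠ 0 → p = p₀ := by
    intro p hp
    by_contra h'
    exact hp (if_neg h')
  refine ⟨?_, ⟨{p₀}, ?_, ?_⟩, ?_, ?_⟩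
  · intro p
    unfold vtx
    split <;> norm_num
  · intro p hp
    exact if_neg (by simpa using hp)
  · simp [vtx]
  · intro p hp
    rwa [hsupp p hp]
  · intro a ha b hb hab
    exact absurd ((hsupp a ha).trans (hsupp b hb).symm) hab

/-- Pushforward of weights along a map of vertex sets: the simplicial map induced on
realizations of order complexes. -/
def pushf {P Q : Type} (g : P → Q) (f : P → ℝ) : Q → ℝ :=
  fun q => ∑ᶠ p ∈ g ⁻¹' {q}, f p

/-! ### The fundamental group of an oriented graph -/

/-- The vertices of `G`, as a quiver. -/
abbrev QV (G : OrientedGraph) : Type := G.V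

instance (G : OrientedGraph) : Quiver (QV G) :=
  ⟨fun a b => {e : G.E // G.src e = a ∧ G.tgt e = b}⟩

/-- The class, in the free groupoid on the graph `G`, of a walk. -/
def walkHom (G : OrientedGraph) : (v : G.V) → (l : List (G.E × Bool)) → G.WalkFrom v l →
    ((Quiver.FreeGroupoid.of (QV G)).obj v ⟶ (Quiver.FreeGroupoid.of (QV G)).obj (G.walkEnd v l))
  | _, [], _ => 𝟙 _
  | v, (e, true) :: l, h =>
      eqToHom (congrArg (Quiver.FreeGroupoid.of (QV G)).obj h.1.symm) ≫
        ((Quiver.FreeGroupoid.of (QV G)).map (X := G.src e) (Y := G.tgt e) ⟨e, rfl, rfl⟩ ≫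
          walkHom G _ l h.2)
  | v, (e, false) :: l, h =>
      eqToHom (congrArg (Quiver.FreeGroupoid.of (QV G)).obj h.1.symm) ≫
        (Groupoid.inv ((Quiver.FreeGroupoid.of (QV G)).map (X := G.src e) (Y := G.tgt e) ⟨e, rfl, rfl⟩) ≫
          walkHom G _ l h.2)

/-- The class of a walk in the free groupoid on the graph. -/
def GWalk.toHom {G : OrientedGraph} (w : GWalk G) :
    ((Quiver.FreeGroupoid.of (QV G)).obj w.start ⟶ (Quiver.FreeGroupoid.of (QV G)).obj w.endV) :=
  walkHom G w.start w.steps w.valid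

/-- The fundamental group `π₁` of the graph `G` based at `v`: the vertex group of the free
groupoid on `G`. -/
abbrev Pi1 (G : OrientedGraph) (v : G.V) : Type :=
  ((Quiver.FreeGroupoid.of (QV G)).obj v ⟶ (Quiver.FreeGroupoid.of (QV G)).obj v)

/-- The class in `π₁(G, v₀)` of the loop `δ γ₁ γ₂⁻¹ δ⁻¹`, where `γ₁, γ₂` have common
endpoints and `δ` is a base path from `v₀`. -/
def loopClass {G : OrientedGraph} {v₀ : G.V} (δ γ₁ γ₂ : GWalk G)
    (hδs : δ.start = v₀) (hδe : δ.endV = γ₁.start)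
    (hs : γ₁.start = γ₂.start) (he : γ₁.endV = γ₂.endV) : Pi1 G v₀ :=
  eqToHom (congrArg (Quiver.FreeGroupoid.of (QV G)).obj hδs.symm) ≫ δ.toHom ≫
    eqToHom (congrArg (Quiver.FreeGroupoid.of (QV G)).obj hδe) ≫ γ₁.toHom ≫
    eqToHom (congrArg (Quiver.FreeGroupoid.of (QV G)).obj he) ≫ Groupoid.inv γ₂.toHom ≫
    eqToHom (congrArg (Quiver.FreeGroupoid.of (QV G)).obj (hs.symm.trans hδe.symm)) ≫
    Groupoid.inv δ.toHom ≫ eqToHom (congrArg (Quiver.FreeGroupoid.of (QV G)).obj hδs)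

/-- The set of classes of loops `γ₁ γ₂⁻¹` with `ρ(γ₁) ∼ ρ(γ₂)`, transported to the base
vertex `v₀` via the fixed base paths `δ`. -/
def SigmaSet {Θ Γ : OrientedGraph} (ρ : GraphMor Θ Γ) (SΓ : OrientedSystem Γ)
    (v₀ : Θ.V) (δ : Θ.V → GWalk Θ) : Set (Pi1 Θ v₀) :=
  {g | ∃ (γ₁ γ₂ : GWalk Θ) (hδs : (δ γ₁.start).start = v₀)
      (hδe : (δ γ₁.start).endV = γ₁.start)
      (hs : γ₁.start = γ₂.start) (he : γ₁.endV = γ₂.endV),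
      SΓ.rel (ρ.mapWalk γ₁) (ρ.mapWalk γ₂) ∧
      g = loopClass (δ γ₁.start) γ₁ γ₂ hδs hδe hs he}


/-- `C'` is the chamber opposite to `C` with respect to the codimension-2 face `F`: the
chamber adjacent to `F` separated from `C` by every hyperplane containing `|F|`. -/
def OppChamber {d : ℕ} (𝒜 : Finset (Set (Fin d → ℝ))) (F C C' : Set (Fin d → ℝ)) : Prop :=
  IsChamber 𝒜 C' ∧ FaceGT F C' ∧
    ∀ H ∈ 𝒜, (affineSpan ℝ F : Set (Fin d → ℝ)) ⊆ H → Separates H C C'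

/-- The set of classes of the loops `β₁(F,v)·β₂(F,v)⁻¹`, where `β₁(F,v), β₂(F,v)` are the
lifts at `v` of the positive minimal paths of `Γ(𝒜)` from `ρ(v)` to the chamber opposite to
`ρ(v)` w.r.t. the codimension-2 face `F`, all of whose vertices are chambers `C` with
`F > C`. -/
def FlagLoopSet {d : ℕ} (𝒜 : Finset (Set (Fin d → ℝ))) {Θ : OrientedGraph}
    (ρ : GraphMor Θ (chamberGraph 𝒜)) (v₀ : Θ.V) (δ : Θ.V → GWalk Θ) :
    Set (Pi1 Θ v₀) :=
  {g | ∃ (F : Set (Fin d → ℝ)) (_ : F ∈ Faces 𝒜)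
      (_ : Module.finrank ℝ (affineSpan ℝ F).direction = d - 2)
      (γ₁ γ₂ : GWalk Θ) (_ : FaceGT F (ρ.onV γ₁.start).1)
      (_ : IsMinPos (chamberGraph 𝒜) (ρ.mapWalk γ₁))
      (_ : IsMinPos (chamberGraph 𝒜) (ρ.mapWalk γ₂))
      (_ : ∀ u ∈ (ρ.mapWalk γ₁).vertices, FaceGT F u.1)
      (_ : ∀ u ∈ (ρ.mapWalk γ₂).vertices, FaceGT F u.1)
      (_ : OppChamber 𝒜 F (ρ.onV γ₁.start).1 ((ρ.mapWalk γ₁).endV).1)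
      (_ : OppChamber 𝒜 F (ρ.onV γ₁.start).1 ((ρ.mapWalk γ₂).endV).1)
      (hδs : (δ γ₁.start).start = v₀) (hδe : (δ γ₁.start).endV = γ₁.start)
      (hs : γ₁.start = γ₂.start) (he : γ₁.endV = γ₂.endV),
      g = loopClass (δ γ₁.start) γ₁ γ₂ hδs hδe hs he}


namespace Geo

def Rep {d : ℕ} (𝒜 : Finset (Set (Fin d → ℝ)))
    (f : Set (Fin d → ℝ) → ((Fin d → ℝ) →ᵃ[ℝ] ℝ)) : Prop :=
  ∀ H ∈ 𝒜, ∀ x, x ∈ H ↔ f H x = 0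

def sg {d : ℕ} (f : Set (Fin d → ℝ) → ((Fin d → ℝ) →ᵃ[ℝ] ℝ)) (C H : Set (Fin d → ℝ)) : Prop :=
  ∃ x ∈ C, 0 < f H x

theorem exists_rep {d : ℕ} {𝒜 : Finset (Set (Fin d → ℝ))} (h𝒜 : IsArrangement 𝒜)
    (q : Fin d → ℝ) (hq : ∀ H ∈ 𝒜, q ∉ H) :
    ∃ f : Set (Fin d → ℝ) → ((Fin d → ℝ) →ᵃ[ℝ] ℝ), Rep 𝒜 f ∧ ∀ H ∈ 𝒜, f H q = -1 := by
  have : ∀ H : Set (Fin d → ℝ), ∃ g : (Fin d → ℝ) →ᵃ[ℝ] ℝ, H ∈ 𝒜 →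
      (∀ x, x ∈ H ↔ g x = 0) ∧ g q = -1 := by
    intro H
    by_cases hH : H ∈ 𝒜
    · obtain ⟨a, b, -, rfl⟩ := h𝒜 H hH
      have hq' : ∑ i, a i * q i - b ≠ 0 := by
        intro h
        exact hq _ hH (by simpa [sub_eq_zero] using h)
      let g₀ : (Fin d → ℝ) →ᵃ[ℝ] ℝ :=
        (∑ i, a i • (LinearMap.proj i : (Fin d → ℝ) →ₗ[ℝ] ℝ)).toAffineMap -
          AffineMap.const ℝ _ b
      have hg : ∀ x, g₀ x = ∑ i, a i * x i - b := by
        intro x; simp [g₀]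
      refine ⟨(-(∑ i, a i * q i - b)⁻¹) • g₀, fun _ => ⟨fun x => ?_, ?_⟩⟩
      · simp [hg, hq', sub_eq_zero]
      · simp [hg, hq']
    · exact ⟨0, fun h => absurd h hH⟩
  choose f hf using this
  exact ⟨f, fun H hH => (hf H hH).1, fun H hH => (hf H hH).2⟩

theorem aff_cont {d : ℕ} (g : (Fin d → ℝ) →ᵃ[ℝ] ℝ) : Continuous g :=
  g.continuous_of_finiteDimensional

theorem conn_comp {d : ℕ} {ι : Type} (s : Finset ι) (g : ι → ((Fin d → ℝ) →ᵃ[ℝ] ℝ))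
    (x : Fin d → ℝ) (hx : ∀ i ∈ s, g i x ≠ 0) :
    connectedComponentIn {y | ∀ i ∈ s, g i y ≠ 0} x = {y | ∀ i ∈ s, 0 < g i x * g i y} := by
  apply Set.Subset.antisymm
  · intro y hy i hi
    by_contra hneg
    have hy0 : g i y ≠ 0 := (connectedComponentIn_subset _ _ hy) i hi
    have hx0 := hx i hi
    have hpre : _root_.IsPreconnected (g i '' connectedComponentIn {y | ∀ i ∈ s, g i y ≠ 0} x) :=
      isPreconnected_connectedComponentIn.image _ (aff_cont _).continuousOn
    have hxm : g i x ∈ g i '' connectedComponentIn {y | ∀ i ∈ s, g i y ≠ 0} x :=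
      ⟨x, mem_connectedComponentIn hx, rfl⟩
    have hym : g i y ∈ g i '' connectedComponentIn {y | ∀ i ∈ s, g i y ≠ 0} x := ⟨y, hy, rfl⟩
    have h0 : (0 : ℝ) ∈ g i '' connectedComponentIn {y | ∀ i ∈ s, g i y ≠ 0} x := by
      have hoc := hpre.ordConnected
      rcases lt_or_gt_of_ne hx0 with h1 | h1 <;> rcases lt_or_gt_of_ne hy0 with h2 | h2
      · exact absurd (mul_pos_of_neg_of_neg h1 h2) hneg
      · exact hoc.out hxm hym ⟨h1.le, h2.le⟩
      · exact hoc.out hym hxm ⟨h2.le, h1.le⟩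
      · exact absurd (mul_pos h1 h2) hneg
    obtain ⟨z, hz, hz0⟩ := h0
    exact (connectedComponentIn_subset _ _ hz) i hi hz0
  · apply _root_.IsPreconnected.subset_connectedComponentIn
    · apply Convex.isPreconnected
      have : {y | ∀ i ∈ s, 0 < g i x * g i y} = ⋂ i ∈ s, (g i x • g i) ⁻¹' (Set.Ioi 0) := by
        ext y; simp
      rw [this]
      exact convex_iInter₂ fun i _ => (convex_Ioi 0).affine_preimage _
    · intro i hi
      exact mul_self_pos.2 (hx i hi)
    · intro y hy i hi h0
      have := hy i hi
      rw [h0] at this; simp at this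

section
variable {d : ℕ} {𝒜 : Finset (Set (Fin d → ℝ))}
  {f : Set (Fin d → ℝ) → ((Fin d → ℝ) →ᵃ[ℝ] ℝ)}

theorem compl_eq (hf : Rep 𝒜 f) : (ArrUnion 𝒜)ᶜ = {y | ∀ H ∈ 𝒜, f H y ≠ 0} := by
  ext y
  simp only [ArrUnion, Set.mem_compl_iff, Set.mem_iUnion, not_exists, Set.mem_ofPred_eq]
  exact forall₂_congr fun H hH => not_congr (hf H hH y)

theorem chamber_at (hf : Rep 𝒜 f) {x : Fin d → ℝ} (hx : ∀ H ∈ 𝒜, f H x ≠ 0) :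
    connectedComponentIn (ArrUnion 𝒜)ᶜ x = {y | ∀ H ∈ 𝒜, 0 < f H x * f H y} := by
  rw [compl_eq hf]; exact conn_comp 𝒜 f x hx

theorem mem_chamber (hf : Rep 𝒜 f) {C : Set (Fin d → ℝ)} (hC : IsChamber 𝒜 C) (x : Fin d → ℝ) :
    x ∈ C ↔ ∀ H ∈ 𝒜, f H x ≠ 0 ∧ (0 < f H x ↔ sg f C H) := by
  obtain ⟨y, hy, rfl⟩ := hC
  have hy' : ∀ H ∈ 𝒜, f H y ≠ 0 := by
    have : y ∈ (ArrUnion 𝒜)ᶜ := hy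
    rwa [compl_eq hf] at this
  rw [chamber_at hf hy']
  have hyy : ∀ H ∈ 𝒜, 0 < f H y * f H y := fun H hH => mul_self_pos.2 (hy' H hH)
  have hsg : ∀ H ∈ 𝒜, (sg f {z | ∀ H ∈ 𝒜, 0 < f H y * f H z} H ↔ 0 < f H y) := by
    intro H hH
    constructor
    · rintro ⟨z, hz, hz0⟩
      exact (pos_iff_pos_of_mul_pos (hz H hH)).2 hz0
    · intro h
      exact ⟨y, hyy, h⟩
  apply forall₂_congr
  intro H hH
  rw [hsg H hH]
  constructor
  · intro h
    exact ⟨fun h0 => by rw [h0] at h; simp at h, (pos_iff_pos_of_mul_pos h).symm⟩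
  · rintro ⟨h0, h1⟩
    rcases lt_or_gt_of_ne h0 with h | h
    · have : f H y < 0 := lt_of_le_of_ne (not_lt.1 fun h2 => absurd (h1.2 h2) h.not_gt) (hy' H hH)
      exact mul_pos_of_neg_of_neg this h
    · exact mul_pos (h1.1 h) h

theorem chamber_nonempty {C : Set (Fin d → ℝ)} (hC : IsChamber 𝒜 C) : C.Nonempty := by
  obtain ⟨y, hy, rfl⟩ := hC
  exact ⟨y, mem_connectedComponentIn hy⟩

theorem chamber_ext (hf : Rep 𝒜 f) {A B : Set (Fin d → ℝ)} (hA : IsChamber 𝒜 A)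
    (hB : IsChamber 𝒜 B) (h : ∀ H ∈ 𝒜, (sg f A H ↔ sg f B H)) : A = B := by
  ext x
  rw [mem_chamber hf hA, mem_chamber hf hB]
  exact forall₂_congr fun H hH => by rw [h H hH]

theorem chamber_of_pt (hf : Rep 𝒜 f) {x : Fin d → ℝ} (hx : ∀ H ∈ 𝒜, f H x ≠ 0) :
    ∃ C : (chamberGraph 𝒜).V, x ∈ C.1 ∧ ∀ H ∈ 𝒜, (sg f C.1 H ↔ 0 < f H x) := by
  have hx' : x ∈ (ArrUnion 𝒜)ᶜ := by rw [compl_eq hf]; exact hx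
  have hC : IsChamber 𝒜 (connectedComponentIn (ArrUnion 𝒜)ᶜ x) := ⟨x, hx', rfl⟩
  have hm := mem_connectedComponentIn hx'
  exact ⟨⟨_, hC⟩, hm, fun H hH => (((mem_chamber hf hC x).1 hm) H hH).2.symm⟩

theorem sameSide_iff (hf : Rep 𝒜 f) {H : Set (Fin d → ℝ)} (hH : H ∈ 𝒜) {x y : Fin d → ℝ}
    (hx : f H x ≠ 0) (hy : f H y ≠ 0) : SameSide H x y ↔ (0 < f H x ↔ 0 < f H y) := by
  have hc : Hᶜ = {y | ∀ K ∈ ({H} : Finset (Set (Fin d → ℝ))), f K y ≠ 0} := by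
    ext z; simp [hf H hH z]
  have key : ∀ z, f H z ≠ 0 → connectedComponentIn Hᶜ z = {y | 0 < f H z * f H y} := by
    intro z hz
    rw [hc, conn_comp {H} f z (by simpa using hz)]
    simp
  unfold SameSide
  rw [key x hx, key y hy]
  constructor
  · intro h
    have : x ∈ {z | 0 < f H y * f H z} := by
      rw [← h]; exact mul_self_pos.2 hx
    exact (pos_iff_pos_of_mul_pos this).symm
  · intro h
    ext z
    simp only [Set.mem_ofPred_eq]
    rcases lt_or_gt_of_ne hx with h1 | h1
    · have h2 : f H y < 0 := lt_of_le_of_ne (not_lt.1 fun h2 => absurd (h.2 h2) h1.not_gt) hy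
      rw [mul_pos_iff, mul_pos_iff]; simp [h1, h2, h1.not_gt, h2.not_gt]
    · have h2 := h.1 h1
      rw [mul_pos_iff, mul_pos_iff]; simp [h1, h2, h1.not_gt, h2.not_gt]

theorem separates_iff (hf : Rep 𝒜 f) {A B H : Set (Fin d → ℝ)} (hA : IsChamber 𝒜 A)
    (hB : IsChamber 𝒜 B) (hH : H ∈ 𝒜) : Separates H A B ↔ ¬ (sg f A H ↔ sg f B H) := by
  constructor
  · rintro ⟨x, hx, y, hy, -, -, h⟩
    have h1 := (mem_chamber hf hA x).1 hx H hH
    have h2 := (mem_chamber hf hB y).1 hy H hH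
    rwa [sameSide_iff hf hH h1.1 h2.1, h1.2, h2.2] at h
  · intro h
    obtain ⟨x, hx⟩ := chamber_nonempty hA
    obtain ⟨y, hy⟩ := chamber_nonempty hB
    have h1 := (mem_chamber hf hA x).1 hx H hH
    have h2 := (mem_chamber hf hB y).1 hy H hH
    refine ⟨x, hx, y, hy, ?_, ?_, ?_⟩
    · rw [hf H hH]; exact h1.1
    · rw [hf H hH]; exact h2.1
    · rwa [sameSide_iff hf hH h1.1 h2.1, h1.2, h2.2]

/-- generic points -/
theorem exists_generic {ι : Type} (s : Finset ι) (g : ι → ((Fin d → ℝ) →ᵃ[ℝ] ℝ))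
    (hg : ∀ i ∈ s, ∃ x, g i x ≠ 0) {U : Set (Fin d → ℝ)} (hU : IsOpen U) (hne : U.Nonempty) :
    ∃ x ∈ U, ∀ i ∈ s, g i x ≠ 0 := by
  induction s using Finset.induction_on generalizing U with
  | empty => obtain ⟨x, hx⟩ := hne; exact ⟨x, hx, by simp⟩
  | insert a s ha ih =>
    have hV : IsOpen (U ∩ {x | g a x ≠ 0}) :=
      hU.inter (isOpen_ne_fun (aff_cont _) continuous_const)
    have hVne : (U ∩ {x | g a x ≠ 0}).Nonempty := by
      obtain ⟨x, hx⟩ := hne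
      by_cases h0 : g a x = 0
      · obtain ⟨y, hy⟩ := hg a (by simp)
        have hcont : Filter.Tendsto (fun t : ℝ => AffineMap.lineMap x y t) (nhdsWithin 0 (Set.Ioi 0))
            (nhds x) := by
          have : Continuous (fun t : ℝ => AffineMap.lineMap x y t) := AffineMap.lineMap_continuous
          have h := this.tendsto 0
          simp only [AffineMap.lineMap_apply_zero] at h
          exact h.mono_left nhdsWithin_le_nhds
        have h1 := hcont.eventually (hU.mem_nhds hx)
        obtain ⟨t, ht, ht0⟩ := (h1.and self_mem_nhdsWithin).exists
        refine ⟨_, ht, ?_⟩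
        have ht0' : (0:ℝ) < t := ht0
        simp only [Set.mem_ofPred_eq, AffineMap.apply_lineMap, h0]
        simp [AffineMap.lineMap_apply, ht0'.ne', hy]
      · exact ⟨x, hx, h0⟩
    obtain ⟨x, hx, hxs⟩ := ih (fun i hi => hg i (by simp [hi])) hV hVne
    refine ⟨x, hx.1, fun i hi => ?_⟩
    rcases Finset.mem_insert.1 hi with rfl | hi
    · exact hx.2
    · exact hxs i hi

theorem chamber_open (hf : Rep 𝒜 f) {C : Set (Fin d → ℝ)} (hC : IsChamber 𝒜 C) : IsOpen C := by
  obtain ⟨y, hy, rfl⟩ := hC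
  have hy' : ∀ H ∈ 𝒜, f H y ≠ 0 := by
    have : y ∈ (ArrUnion 𝒜)ᶜ := hy
    rwa [compl_eq hf] at this
  rw [chamber_at hf hy']
  have : {z | ∀ H ∈ 𝒜, 0 < f H y * f H z} = ⋂ H ∈ 𝒜, {z | 0 < f H y * f H z} := by
    ext; simp
  rw [this]
  exact isOpen_biInter_finset fun H _ =>
    isOpen_lt continuous_const (continuous_const.mul (aff_cont _))

end
end Geo

namespace Geo
section
variable {d : ℕ} {𝒜 : Finset (Set (Fin d → ℝ))}
  {f : Set (Fin d → ℝ) → ((Fin d → ℝ) →ᵃ[ℝ] ℝ)}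

def dst (A B : (chamberGraph 𝒜).V) : ℕ := (𝒜.filter (fun H => Separates H A.1 B.1)).card

def PW (A B : (chamberGraph 𝒜).V) (l : List ((chamberGraph 𝒜).E × Bool)) : Prop :=
  (chamberGraph 𝒜).WalkFrom A l ∧ (∀ s ∈ l, s.2 = true) ∧ (chamberGraph 𝒜).walkEnd A l = B

theorem PW.append {A B C : (chamberGraph 𝒜).V} {l₁ l₂ : List ((chamberGraph 𝒜).E × Bool)}
    (h₁ : PW A B l₁) (h₂ : PW B C l₂) : PW A C (l₁ ++ l₂) := by
  refine ⟨(chamberGraph 𝒜).walkFrom_append _ _ _ h₁.1 (by rw [h₁.2.2]; exact h₂.1), ?_, ?_⟩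
  · intro s hs
    rcases List.mem_append.1 hs with h | h
    · exact h₁.2.1 s h
    · exact h₂.2.1 s h
  · rw [(chamberGraph 𝒜).walkEnd_append, h₁.2.2, h₂.2.2]

theorem PW.cons {A B C : (chamberGraph 𝒜).V} {l : List ((chamberGraph 𝒜).E × Bool)}
    (hadj : Adjacent 𝒜 A.1 B.1) (h : PW B C l) : PW A C ((⟨(A, B), hadj⟩, true) :: l) := by
  refine ⟨⟨rfl, h.1⟩, ?_, h.2.2⟩
  intro s hs
  rcases List.mem_cons.1 hs with rfl | hs
  · rfl
  · exact h.2.1 s hs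

theorem PW.uncons {A C : (chamberGraph 𝒜).V} {s : (chamberGraph 𝒜).E × Bool}
    {l : List ((chamberGraph 𝒜).E × Bool)} (h : PW A C (s :: l)) :
    ∃ (B : (chamberGraph 𝒜).V) (hadj : Adjacent 𝒜 A.1 B.1),
      s = (⟨(A, B), hadj⟩, true) ∧ PW B C l := by
  obtain ⟨⟨h1, h2⟩, h3, h4⟩ := h
  have hs := h3 s (by simp)
  rcases s with ⟨⟨⟨A', B⟩, hadj⟩, b⟩
  simp only at hs
  subst hs
  have : A' = A := h1
  subst this
  exact ⟨B, hadj, rfl, h2, fun s hs => h3 s (by simp [hs]), h4⟩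

theorem adj_of_sg (hf : Rep 𝒜 f) (A B : (chamberGraph 𝒜).V) {i : Set (Fin d → ℝ)} (hi : i ∈ 𝒜)
    (hA : sg f A.1 i) (h : ∀ H ∈ 𝒜, (sg f B.1 H ↔ sg f A.1 H ∧ H ≠ i)) :
    Adjacent 𝒜 A.1 B.1 := by
  refine ⟨i, ⟨hi, (separates_iff hf A.2 B.2 hi).2 ?_⟩, ?_⟩
  · rw [h i hi]; tauto
  · rintro K ⟨hK, hs⟩
    rw [separates_iff hf A.2 B.2 hK, h K hK] at hs
    tauto

theorem dst_triangle (hf : Rep 𝒜 f) (A B C : (chamberGraph 𝒜).V) :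
    dst A C ≤ dst A B + dst B C := by
  unfold dst
  refine le_trans (Finset.card_le_card ?_) (Finset.card_union_le _ _)
  intro H hH
  simp only [Finset.mem_union, Finset.mem_filter] at hH ⊢
  obtain ⟨hH, hs⟩ := hH
  rw [separates_iff hf A.2 C.2 hH] at hs
  rw [separates_iff hf A.2 B.2 hH, separates_iff hf B.2 C.2 hH]
  tauto

theorem dst_adj {A B : (chamberGraph 𝒜).V} (h : Adjacent 𝒜 A.1 B.1) : dst A B = 1 := by
  obtain ⟨H, hH, huniq⟩ := h
  unfold dst
  rw [Finset.card_eq_one]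
  refine ⟨H, ?_⟩
  ext K
  simp only [Finset.mem_filter, Finset.mem_singleton]
  exact ⟨fun hK => huniq K hK, fun hK => hK ▸ hH⟩

theorem dst_self (hf : Rep 𝒜 f) (A : (chamberGraph 𝒜).V) : dst A A = 0 := by
  unfold dst
  rw [Finset.card_eq_zero, Finset.filter_eq_empty_iff]
  intro H hH hs
  rw [separates_iff hf A.2 A.2 hH] at hs
  exact hs Iff.rfl

theorem dst_le_length (hf : Rep 𝒜 f) (l : List ((chamberGraph 𝒜).E × Bool)) :
    ∀ A B : (chamberGraph 𝒜).V, PW A B l → dst A B ≤ l.length := by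
  induction l with
  | nil =>
    rintro A B ⟨-, -, h⟩
    have : A = B := h
    subst this
    rw [dst_self hf]; simp
  | cons s l ih =>
    intro A C h
    obtain ⟨B, hadj, -, hB⟩ := h.uncons
    have := ih B C hB
    have h2 := dst_triangle hf A B C
    rw [dst_adj hadj] at h2
    simp only [List.length_cons]; omega

theorem gallery (hf : Rep 𝒜 f) (τ : Set (Fin d → ℝ) → ℝ) : ∀ (n : ℕ) (J : Finset (Set (Fin d → ℝ)))
    (_ : J.card = n) (_ : J ⊆ 𝒜) (A : (chamberGraph 𝒜).V) (_ : ∀ K ∈ J, sg f A.1 K)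
    (_ : Set.InjOn τ J) (a : ℝ)
    (_ : ∀ c, a < c → (∀ K ∈ J, τ K ≠ c) → ∃ C : (chamberGraph 𝒜).V,
      ∀ H ∈ 𝒜, (sg f C.1 H ↔ (sg f A.1 H ∧ (H ∈ J → c < τ H))))
    (_ : ∀ K ∈ J, a < τ K),
    ∃ (E : (chamberGraph 𝒜).V) (l : List ((chamberGraph 𝒜).E × Bool)),
      PW A E l ∧ l.length = n ∧ (∀ H ∈ 𝒜, (sg f E.1 H ↔ sg f A.1 H ∧ H ∉ J)) ∧
      (∀ u ∈ (chamberGraph 𝒜).visits A l, ∀ H ∈ 𝒜, H ∉ J → (sg f u.1 H ↔ sg f A.1 H)) ∧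
      (∀ i ∈ J, (∀ K ∈ J, τ i ≤ τ K) → ∃ (B : (chamberGraph 𝒜).V) (hadj : Adjacent 𝒜 A.1 B.1)
        (l' : List ((chamberGraph 𝒜).E × Bool)),
        l = (⟨(A, B), hadj⟩, true) :: l' ∧ ∀ H ∈ 𝒜, (sg f B.1 H ↔ sg f A.1 H ∧ H ≠ i)) := by
  intro n
  induction n with
  | zero =>
    intro J hJn hJ A hA hτ a hreal ha
    have hJ0 := Finset.card_eq_zero.1 hJn
    subst hJ0
    refine ⟨A, [], ⟨trivial, by simp, rfl⟩, rfl, by simp, ?_, by simp⟩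
    intro u hu H _ _
    have : u = A := by simpa only [OrientedGraph.visits, List.mem_singleton] using hu
    rw [this]
  | succ n ih =>
    intro J hJn hJ A hA hτ a hreal ha
    have hne : J.Nonempty := by rw [← Finset.card_pos]; omega
    obtain ⟨i, hi, hmin⟩ := J.exists_min_image τ hne
    have hlt : ∀ K ∈ J.erase i, τ i < τ K := by
      intro K hK
      obtain ⟨hKi, hK⟩ := Finset.mem_erase.1 hK
      exact lt_of_le_of_ne (hmin K hK) fun h => hKi (hτ hK hi h.symm)
    have hc : ∃ c, τ i < c ∧ ∀ K ∈ J.erase i, c < τ K := by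
      have h1 : ∀ᶠ c in nhdsWithin (τ i) (Set.Ioi (τ i)), ∀ K ∈ J.erase i, c < τ K := by
        rw [Filter.eventually_all_finset]
        intro K hK
        exact nhdsWithin_le_nhds (Iio_mem_nhds (hlt K hK))
      obtain ⟨c, hc1, hc2⟩ := (h1.and self_mem_nhdsWithin).exists
      exact ⟨c, hc2, hc1⟩
    obtain ⟨c, hci, hcK⟩ := hc
    obtain ⟨B, hB⟩ := hreal c (lt_trans (ha i hi) hci) (by
      intro K hK h
      by_cases hKi : K = i
      · subst hKi; linarith
      · have := hcK K (Finset.mem_erase.2 ⟨hKi, hK⟩); linarith)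
    have hB' : ∀ H ∈ 𝒜, (sg f B.1 H ↔ sg f A.1 H ∧ H ≠ i) := by
      intro H hH
      rw [hB H hH]
      constructor
      · rintro ⟨h1, h2⟩
        exact ⟨h1, fun h => by subst h; have := h2 hi; linarith⟩
      · rintro ⟨h1, h2⟩
        exact ⟨h1, fun h => hcK H (Finset.mem_erase.2 ⟨h2, h⟩)⟩
    have hadj := adj_of_sg hf A B (hJ hi) (hA i hi) hB'
    obtain ⟨E, l, hl, hlen, hE, hvis, -⟩ := ih (J.erase i) (by rw [Finset.card_erase_of_mem hi]; omega)
      ((Finset.erase_subset _ _).trans hJ) B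
      (fun K hK => by
        obtain ⟨hKi, hK⟩ := Finset.mem_erase.1 hK
        exact (hB' K (hJ hK)).2 ⟨hA K hK, hKi⟩)
      (hτ.mono (by simpa using Finset.erase_subset i J)) (τ i)
      (fun c' hc' hne' => by
        obtain ⟨C, hC⟩ := hreal c' (lt_trans (ha i hi) hc') (by
          intro K hK h
          by_cases hKi : K = i
          · subst hKi; linarith
          · exact hne' K (Finset.mem_erase.2 ⟨hKi, hK⟩) h)
        refine ⟨C, fun H hH => ?_⟩
        rw [hC H hH, hB' H hH, Finset.mem_erase]
        by_cases hHi : H = i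
        · subst hHi
          simp [hi, hc'.le]
        · simp [hHi])
      hlt
    refine ⟨E, _, hl.cons hadj, by simp [hlen], ?_, ?_, ?_⟩
    · intro H hH
      rw [hE H hH, hB' H hH, Finset.mem_erase]
      by_cases hHi : H = i
      · subst hHi; simp [hi]
      · simp [hHi]
    · intro u hu H hH hHJ
      rcases List.mem_cons.1 hu with rfl | hu
      · rfl
      · have h1 := hvis u hu H hH (fun h => hHJ (Finset.mem_of_mem_erase h))
        rw [h1, hB' H hH]
        have : H ≠ i := fun h => hHJ (h ▸ hi)
        simp [this]
    · intro j hj hjmin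
      have : j = i := hτ hj hi (le_antisymm (hjmin i hi) (hmin j hj))
      subst this
      exact ⟨B, hadj, l, rfl, hB'⟩

/-- the chamber `B` of `q` is negative. -/
theorem dst_of_neg (hf : Rep 𝒜 f) (A B : (chamberGraph 𝒜).V) (hB : ∀ H ∈ 𝒜, ¬ sg f B.1 H) :
    dst A B = (𝒜.filter (fun H => sg f A.1 H)).card := by
  unfold dst
  congr 1
  apply Finset.filter_congr
  intro H hH
  rw [separates_iff hf A.2 B.2 hH]
  have := hB H hH
  tauto

theorem neg_of_q (hf : Rep 𝒜 f) {q : Fin d → ℝ} (hq : ∀ H ∈ 𝒜, f H q = -1)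
    (B : (chamberGraph 𝒜).V) (hB : q ∈ B.1) : ∀ H ∈ 𝒜, ¬ sg f B.1 H := by
  intro H hH h
  have := ((mem_chamber hf B.2 q).1 hB H hH).2.2 h
  rw [hq H hH] at this; linarith

theorem sub_ne (hf : Rep 𝒜 f) {H K : Set (Fin d → ℝ)} (hH : H ∈ 𝒜) (hK : K ∈ 𝒜) (hne : H ≠ K) :
    ∃ x, (f H - f K) x ≠ 0 := by
  by_contra hcon
  push Not at hcon
  apply hne
  ext x
  have := hcon x
  simp only [AffineMap.coe_sub, Pi.sub_apply, sub_eq_zero] at this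
  rw [hf H hH, hf K hK, this]

theorem exists_rep' (h𝒜 : IsArrangement 𝒜) (B : (chamberGraph 𝒜).V) :
    ∃ (q : Fin d → ℝ) (f : Set (Fin d → ℝ) → ((Fin d → ℝ) →ᵃ[ℝ] ℝ)), q ∈ B.1 ∧ Rep 𝒜 f ∧
      ∀ H ∈ 𝒜, f H q = -1 := by
  obtain ⟨x, hx, hB⟩ := B.2
  have hxB : x ∈ B.1 := by rw [hB]; exact mem_connectedComponentIn hx
  obtain ⟨f, h1, h2⟩ := exists_rep h𝒜 x (fun H hH hxH => hx (by
    simp only [ArrUnion, Set.mem_iUnion]; exact ⟨H, hH, hxH⟩))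
  exact ⟨x, f, hxB, h1, h2⟩

theorem exists_gallery (h𝒜 : IsArrangement 𝒜) (A B : (chamberGraph 𝒜).V) :
    ∃ l, PW A B l ∧ l.length = dst A B := by
  obtain ⟨q, f, hqB, hf, hq⟩ := exists_rep' h𝒜 B
  have hBneg := neg_of_q hf hq B hqB
  rw [dst_of_neg hf A B hBneg]
  obtain ⟨p, hp, hgen⟩ := exists_generic ((𝒜 ×ˢ 𝒜).filter (fun x => x.1 ≠ x.2))
    (fun x : Set (Fin d → ℝ) × Set (Fin d → ℝ) => f x.1 - f x.2)
    (by
      rintro ⟨H, K⟩ h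
      simp only [Finset.mem_filter, Finset.mem_product] at h
      exact sub_ne hf h.1.1 h.1.2 h.2) (chamber_open hf A.2) (chamber_nonempty A.2)
  have hpA := (mem_chamber hf A.2 p).1 hp
  obtain ⟨E, l, hl, hlen, hE, -, -⟩ := gallery hf (fun H => f H p) _
    (𝒜.filter (fun H => sg f A.1 H)) rfl (Finset.filter_subset _ _) A
    (fun K hK => (Finset.mem_filter.1 hK).2)
    (by
      intro H hH K hK h
      by_contra hne
      simp only [Finset.coe_filter, Set.mem_ofPred_eq] at hH hK
      have := hgen (H, K) (by simp [hH.1, hK.1, hne])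
      apply this
      simp only [AffineMap.coe_sub, Pi.sub_apply, sub_eq_zero]
      exact h) 0
    (by
      intro c hc hne
      have h1c : (0:ℝ) < 1 + c := by linarith
      have hval : ∀ H ∈ 𝒜, f H (AffineMap.lineMap q p (1 + c)⁻¹) = (f H p - c) / (1 + c) := by
        intro H hH
        rw [AffineMap.apply_lineMap, hq H hH, AffineMap.lineMap_apply]
        simp only [vsub_eq_sub, smul_eq_mul, vadd_eq_add]
        field_simp
        ring
      have hfp : ∀ H ∈ 𝒜, f H p ≠ c := by
        intro H hH h
        by_cases hs : sg f A.1 H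
        · exact hne H (by simp [hH, hs]) h
        · have := (hpA H hH).2.not.2 hs
          linarith
      obtain ⟨C, -, hC⟩ := chamber_of_pt hf (x := AffineMap.lineMap q p (1 + c)⁻¹) (by
        intro H hH
        rw [hval H hH]
        exact div_ne_zero (sub_ne_zero.2 (hfp H hH)) h1c.ne')
      refine ⟨C, fun H hH => ?_⟩
      rw [hC H hH, hval H hH, div_pos_iff_of_pos_right h1c, sub_pos]
      have h2 := (hpA H hH).2
      simp only [Finset.mem_filter]
      constructor
      · intro h
        exact ⟨h2.1 (by linarith), fun _ => h⟩
      · rintro ⟨h3, h4⟩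
        exact h4 ⟨hH, h3⟩)
    (by
      intro K hK
      obtain ⟨hK, hs⟩ := Finset.mem_filter.1 hK
      exact (hpA K hK).2.2 hs)
  have : E = B := by
    apply Subtype.ext
    apply chamber_ext hf E.2 B.2
    intro H hH
    rw [hE H hH]
    have := hBneg H hH
    simp only [Finset.mem_filter]
    tauto
  subst this
  exact ⟨l, hl, hlen⟩

theorem minpos_iff (h𝒜 : IsArrangement 𝒜) (w : GWalk (chamberGraph 𝒜)) :
    IsMinPos _ w ↔ w.Positive ∧ w.steps.length = dst w.start w.endV := by
  have hle : ∀ w : GWalk (chamberGraph 𝒜), w.Positive → dst w.start w.endV ≤ w.steps.length := by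
    intro w hw
    obtain ⟨q, f, hqB, hf, hq⟩ := exists_rep' h𝒜 w.start
    exact dst_le_length hf w.steps w.start w.endV ⟨w.valid, hw, rfl⟩
  constructor
  · rintro ⟨h1, h2⟩
    refine ⟨h1, le_antisymm ?_ (hle w h1)⟩
    obtain ⟨l, hl, hlen⟩ := exists_gallery h𝒜 w.start w.endV
    have := h2 ⟨w.start, l, hl.1⟩ rfl hl.2.2 hl.2.1
    rw [← hlen]; exact this
  · rintro ⟨h1, h2⟩
    refine ⟨h1, fun w' hs he hw' => ?_⟩
    have := hle w' hw'
    rw [hs, he, ← h2] at this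
    exact this

end
end Geo

namespace Geo
section
variable {d : ℕ} {𝒜 : Finset (Set (Fin d → ℝ))}
  {f : Set (Fin d → ℝ) → ((Fin d → ℝ) →ᵃ[ℝ] ℝ)}

theorem aff_add (g : (Fin d → ℝ) →ᵃ[ℝ] ℝ) (x u : Fin d → ℝ) : g (x + u) = g x + g.linear u := by
  have := g.map_vadd x u
  simp only [vadd_eq_add] at this
  rw [add_comm x u, this, add_comm]

theorem aff_sub (g : (Fin d → ℝ) →ᵃ[ℝ] ℝ) (x y : Fin d → ℝ) : g.linear (x - y) = g x - g y := by
  have := g.linearMap_vsub x y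
  simpa using this

theorem aff_tendsto (g : (Fin d → ℝ) →ᵃ[ℝ] ℝ) (z u : Fin d → ℝ) :
    Filter.Tendsto (fun ε : ℝ => g (z + ε • u)) (nhdsWithin 0 (Set.Ioi 0)) (nhds (g z)) := by
  have hc : Continuous (fun ε : ℝ => g (z + ε • u)) :=
    (aff_cont g).comp (continuous_const.add (continuous_id.smul continuous_const))
  have := hc.tendsto 0
  simp only [zero_smul, add_zero] at this
  exact this.mono_left nhdsWithin_le_nhds

theorem small_sign (z u : Fin d → ℝ) : ∀ᶠ ε : ℝ in nhdsWithin 0 (Set.Ioi 0), ∀ H ∈ 𝒜, f H z ≠ 0 →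
    (f H (z + ε • u) ≠ 0 ∧ (0 < f H (z + ε • u) ↔ 0 < f H z)) := by
  rw [Filter.eventually_all_finset]
  intro H _
  by_cases h0 : f H z = 0
  · simp [h0]
  · have ht := aff_tendsto (f H) z u
    rcases lt_or_gt_of_ne h0 with h | h
    · filter_upwards [ht.eventually (Iio_mem_nhds h)] with ε hε _
      have hε' : f H (z + ε • u) < 0 := hε
      exact ⟨hε'.ne, ⟨fun h1 => absurd h1 hε'.not_gt, fun h1 => absurd h1 h.not_gt⟩⟩
    · filter_upwards [ht.eventually (Ioi_mem_nhds h)] with ε hε _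
      have hε' : 0 < f H (z + ε • u) := hε
      exact ⟨hε'.ne', ⟨fun _ => h, fun _ => hε'⟩⟩

theorem mem_face (hf : Rep 𝒜 f) (z y : Fin d → ℝ) : y ∈ faceOf 𝒜 z ↔
    ∀ H ∈ 𝒜, (f H z = 0 ↔ f H y = 0) ∧ (0 < f H z ↔ 0 < f H y) := by
  apply forall₂_congr
  intro H hH
  rw [hf H hH, hf H hH]
  by_cases hz : f H z = 0
  · simp only [hz, true_iff, not_true, false_imp_iff, and_true, lt_irrefl, false_iff]
    constructor
    · intro h; simp [h]
    · exact fun h => h.1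
  · by_cases hy : f H y = 0
    · simp [hz, hy]
    · simp only [hz, hy, not_false_iff, true_imp_iff, sameSide_iff hf hH hz hy]

theorem face_gt (hf : Rep 𝒜 f) (z : Fin d → ℝ) (C : (chamberGraph 𝒜).V)
    (hC : ∀ H ∈ 𝒜, f H z ≠ 0 → (sg f C.1 H ↔ 0 < f H z)) (hex : ∃ H ∈ 𝒜, f H z = 0) :
    FaceGT (faceOf 𝒜 z) C.1 := by
  constructor
  · apply closure_minimal _ isClosed_closure
    intro y hy
    rw [mem_face hf] at hy
    obtain ⟨c, hc⟩ := chamber_nonempty C.2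
    have hcm := (mem_chamber hf C.2 c).1 hc
    have ht : Filter.Tendsto (fun ε : ℝ => y + ε • (c - z)) (nhdsWithin 0 (Set.Ioi 0)) (nhds y) := by
      have hcont : Continuous (fun ε : ℝ => y + ε • (c - z)) :=
        continuous_const.add (continuous_id.smul continuous_const)
      have := hcont.tendsto 0
      simp only [zero_smul, add_zero] at this
      exact this.mono_left nhdsWithin_le_nhds
    apply mem_closure_of_tendsto ht
    filter_upwards [small_sign (𝒜 := 𝒜) (f := f) y (c - z), self_mem_nhdsWithin] with ε h1 h2
    have hε : (0:ℝ) < ε := h2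
    rw [mem_chamber hf C.2]
    intro H hH
    by_cases hz : f H z = 0
    · have hy0 : f H y = 0 := (hy H hH).1.1 hz
      have hval : f H (y + ε • (c - z)) = ε * f H c := by
        rw [aff_add, LinearMap.map_smul, aff_sub, hy0, hz]; simp
      rw [hval]
      refine ⟨mul_ne_zero hε.ne' (hcm H hH).1, ?_⟩
      rw [mul_pos_iff_of_pos_left hε]
      exact (hcm H hH).2
    · have hy0 : f H y ≠ 0 := fun h => hz ((hy H hH).1.2 h)
      refine ⟨(h1 H hH hy0).1, ?_⟩
      rw [(h1 H hH hy0).2, ← (hy H hH).2, hC H hH hz]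
  · intro heq
    obtain ⟨H, hH, h0⟩ := hex
    have hz : z ∈ faceOf 𝒜 z := (mem_face hf z z).2 (by simp)
    rw [heq] at hz
    exact ((mem_chamber hf C.2 z).1 hz H hH).1 h0

theorem face_dim (hf : Rep 𝒜 f) (z v w : Fin d → ℝ) {i j : Set (Fin d → ℝ)} (hi : i ∈ 𝒜) (hj : j ∈ 𝒜)
    (hiz : f i z = 0) (hjz : f j z = 0)
    (hr : ∀ k ∈ 𝒜, f k z = 0 → ∀ x, f i x = 0 → f j x = 0 → f k x = 0)
    (hdet : (f i).linear v * (f j).linear w - (f j).linear v * (f i).linear w ≠ 0) :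
    Module.finrank ℝ (affineSpan ℝ (faceOf 𝒜 z)).direction = d - 2 := by
  set L : (Fin d → ℝ) →ₗ[ℝ] ℝ × ℝ := (f i).linear.prod (f j).linear with hL
  have hsurj : LinearMap.range L = ⊤ := by
    rw [LinearMap.range_eq_top]
    rintro ⟨x, y⟩
    set D := (f i).linear v * (f j).linear w - (f j).linear v * (f i).linear w with hD
    refine ⟨((x * (f j).linear w - y * (f i).linear w) / D) • v +
      ((y * (f i).linear v - x * (f j).linear v) / D) • w, ?_⟩
    simp only [hL, LinearMap.prod_apply, Function.prod_apply, map_add, map_smul, Prod.smul_mk, Prod.mk_add_mk, smul_eq_mul, Prod.mk.injEq]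
    constructor
    · field_simp
      rw [hD]; ring
    · field_simp
      rw [hD]; ring
  have hzF : z ∈ faceOf 𝒜 z := (mem_face hf z z).2 (by simp)
  have hdir : (affineSpan ℝ (faceOf 𝒜 z)).direction = LinearMap.ker L := by
    apply le_antisymm
    · have : affineSpan ℝ (faceOf 𝒜 z) ≤ AffineSubspace.mk' z (LinearMap.ker L) := by
        rw [affineSpan_le]
        intro y hy
        rw [mem_face hf] at hy
        have h1 := (hy i hi).1.1 hiz
        have h2 := (hy j hj).1.1 hjz
        simp [AffineSubspace.mem_mk', hL, -map_sub, aff_sub, h1, h2, hiz, hjz]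
      have := AffineSubspace.direction_le this
      rwa [AffineSubspace.direction_mk'] at this
    · intro u hu
      have hu' : (f i).linear u = 0 ∧ (f j).linear u = 0 := by
        simpa [hL] using hu
      obtain ⟨ε, h1, h2⟩ := ((small_sign (𝒜 := 𝒜) (f := f) z u).and self_mem_nhdsWithin).exists
      have hε : (0:ℝ) < ε := h2
      have hmem : z + ε • u ∈ faceOf 𝒜 z := by
        rw [mem_face hf]
        intro H hH
        by_cases hz : f H z = 0
        · have : f H (z + ε • u) = 0 := by
            apply hr H hH hz
            · rw [aff_add, hiz, map_smul, hu'.1]; simp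
            · rw [aff_add, hjz, map_smul, hu'.2]; simp
          rw [hz, this]; simp
        · have := h1 H hH hz
          refine ⟨by simp [hz, this.1], this.2.symm⟩
      have := AffineSubspace.vsub_mem_direction (subset_affineSpan ℝ _ hmem)
        (subset_affineSpan ℝ _ hzF)
      simp only [vsub_eq_sub, add_sub_cancel_left] at this
      have h3 := Submodule.smul_mem _ ε⁻¹ this
      rwa [smul_smul, inv_mul_cancel₀ hε.ne', one_smul] at h3
  rw [hdir]
  have := LinearMap.finrank_range_add_finrank_ker L
  rw [hsurj] at this
  simp at this
  omega

theorem realize (hf : Rep 𝒜 f) (z u : Fin d → ℝ) (J : Finset (Set (Fin d → ℝ)))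
    (hJ : ∀ H ∈ 𝒜, (H ∈ J ↔ f H z = 0)) (hJ𝒜 : J ⊆ 𝒜) (A : (chamberGraph 𝒜).V) (hA : ∀ K ∈ J, sg f A.1 K)
    (hA' : ∀ H ∈ 𝒜, f H z ≠ 0 → (sg f A.1 H ↔ 0 < f H z)) (τ : Set (Fin d → ℝ) → ℝ) (c : ℝ)
    (hu : ∀ K ∈ J, (f K).linear u = τ K - c) (hne : ∀ K ∈ J, τ K ≠ c) :
    ∃ C : (chamberGraph 𝒜).V, ∀ H ∈ 𝒜, (sg f C.1 H ↔ (sg f A.1 H ∧ (H ∈ J → c < τ H))) := by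
  obtain ⟨ε, h1, h2⟩ := ((small_sign (𝒜 := 𝒜) (f := f) z u).and self_mem_nhdsWithin).exists
  have hε : (0:ℝ) < ε := h2
  have hval : ∀ K ∈ J, f K (z + ε • u) = ε * (τ K - c) := by
    intro K hK
    rw [aff_add, (hJ K (hJ𝒜 hK)).1 hK, map_smul, hu K hK]; simp
  obtain ⟨C, -, hC⟩ := chamber_of_pt hf (x := z + ε • u) (by
    intro H hH
    by_cases hHJ : H ∈ J
    · rw [hval H hHJ]
      exact mul_ne_zero hε.ne' (sub_ne_zero.2 (hne H hHJ))
    · exact (h1 H hH (fun h => hHJ ((hJ H hH).2 h))).1)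
  refine ⟨C, fun H hH => ?_⟩
  rw [hC H hH]
  by_cases hHJ : H ∈ J
  · rw [hval H hHJ, mul_pos_iff_of_pos_left hε, sub_pos]
    simp [hHJ, hA H hHJ]
  · have h0 : f H z ≠ 0 := fun h => hHJ ((hJ H hH).2 h)
    rw [(h1 H hH h0).2, hA' H hH h0]
    simp [hHJ]

def FlipHyp (R : OrientedSystem (chamberGraph 𝒜)) : Prop :=
  ∀ F ∈ Faces 𝒜, Module.finrank ℝ (affineSpan ℝ F).direction = d - 2 →
    ∀ α β : GWalk (chamberGraph 𝒜), FaceGT F α.start.1 →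
      IsMinPos (chamberGraph 𝒜) α → IsMinPos (chamberGraph 𝒜) β →
      (∀ u ∈ α.vertices, FaceGT F u.1) → (∀ u ∈ β.vertices, FaceGT F u.1) →
      OppChamber 𝒜 F α.start.1 α.endV.1 → OppChamber 𝒜 F α.start.1 β.endV.1 →
      α.start = β.start → α.endV = β.endV → R.rel α β

def RR (R : OrientedSystem (chamberGraph 𝒜)) (A : (chamberGraph 𝒜).V)
    (l₁ l₂ : List ((chamberGraph 𝒜).E × Bool)) : Prop :=
  ∃ h₁ h₂, R.rel ⟨A, l₁, h₁⟩ ⟨A, l₂, h₂⟩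

theorem RR.trans {R : OrientedSystem (chamberGraph 𝒜)} {A : (chamberGraph 𝒜).V}
    {l₁ l₂ l₃ : List ((chamberGraph 𝒜).E × Bool)} (h : RR R A l₁ l₂) (h' : RR R A l₂ l₃) :
    RR R A l₁ l₃ := by
  obtain ⟨h1, h2, h3⟩ := h
  obtain ⟨h4, h5, h6⟩ := h'
  exact ⟨h1, h5, R.rel_trans h3 h6⟩

theorem RR.comp {R : OrientedSystem (chamberGraph 𝒜)} {A B C : (chamberGraph 𝒜).V}
    {l₁ l₂ m n : List ((chamberGraph 𝒜).E × Bool)} (h : RR R B l₁ l₂) (hm : PW A B m)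
    (hl₁ : PW B C l₁) (hn : (chamberGraph 𝒜).WalkFrom C n) :
    RR R A (m ++ l₁ ++ n) (m ++ l₂ ++ n) := by
  obtain ⟨h1, h2, h3⟩ := h
  have he : (GWalk.mk B l₁ h1).endV = (GWalk.mk B l₂ h2).endV := R.rel_endV h3
  have he1 : (chamberGraph 𝒜).walkEnd B l₁ = C := hl₁.2.2
  have he2 : (chamberGraph 𝒜).walkEnd B l₂ = C := he.symm.trans he1
  have key := R.rel_comp ⟨A, m, hm.1⟩ ⟨C, n, hn⟩ h3 hm.2.2 he1
  have eq : ∀ (l : List ((chamberGraph 𝒜).E × Bool)) (hl : (chamberGraph 𝒜).WalkFrom B l)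
      (_ : (chamberGraph 𝒜).walkEnd B l = C), ∃ h',
      ((GWalk.mk A m hm.1).append' ⟨B, l, hl⟩).append' ⟨C, n, hn⟩ = ⟨A, m ++ l ++ n, h'⟩ := by
    intro l hl hle
    have e1 : (GWalk.mk A m hm.1).endV = (GWalk.mk B l hl).start := hm.2.2
    have w1 : (chamberGraph 𝒜).WalkFrom A (m ++ l) :=
      (chamberGraph 𝒜).walkFrom_append _ _ _ hm.1 (by rw [hm.2.2]; exact hl)
    have e2 : (chamberGraph 𝒜).walkEnd A (m ++ l) = C := by
      rw [(chamberGraph 𝒜).walkEnd_append, hm.2.2, hle]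
    refine ⟨(chamberGraph 𝒜).walkFrom_append _ _ _ w1 (by rw [e2]; exact hn), ?_⟩
    have : (GWalk.mk A m hm.1).append' ⟨B, l, hl⟩ = ⟨A, m ++ l, w1⟩ := by
      rw [GWalk.append', dif_pos e1]
    rw [this, GWalk.append', dif_pos]
    exact e2
  obtain ⟨w1, e1⟩ := eq l₁ h1 he1
  obtain ⟨w2, e2⟩ := eq l₂ h2 he2
  rw [e1, e2] at key
  exact ⟨w1, w2, key⟩

theorem flip (h𝒜 : IsArrangement 𝒜) (hf : Rep 𝒜 f) {R : OrientedSystem (chamberGraph 𝒜)} (hR : FlipHyp R)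
    (A : (chamberGraph 𝒜).V) (z v w : Fin d → ℝ) (J : Finset (Set (Fin d → ℝ)))
    (hJ : ∀ H ∈ 𝒜, (H ∈ J ↔ f H z = 0)) (hJ𝒜 : J ⊆ 𝒜) (hA : ∀ K ∈ J, sg f A.1 K)
    (hA' : ∀ H ∈ 𝒜, f H z ≠ 0 → (sg f A.1 H ↔ 0 < f H z)) (σ : Set (Fin d → ℝ) → ℝ)
    (hσ : Set.InjOn σ J) (hv : ∀ K ∈ J, (f K).linear v = -1) (hw : ∀ K ∈ J, (f K).linear w = σ K)
    {i j : Set (Fin d → ℝ)} (hi : i ∈ J) (hj : j ∈ J) (hij : i ≠ j)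
    (hmax : ∀ k ∈ J, σ k ≤ σ i) (hmin : ∀ k ∈ J, σ j ≤ σ k)
    (hr : ∀ k ∈ J, ∀ x, f i x = 0 → f j x = 0 → f k x = 0) :
    ∃ (E Bi Bj : (chamberGraph 𝒜).V) (hBi : Adjacent 𝒜 A.1 Bi.1) (hBj : Adjacent 𝒜 A.1 Bj.1)
      (l₁ l₂ : List ((chamberGraph 𝒜).E × Bool)),
      PW A E ((⟨(A, Bi), hBi⟩, true) :: l₁) ∧ PW A E ((⟨(A, Bj), hBj⟩, true) :: l₂) ∧
      ((⟨(A, Bi), hBi⟩, true) :: l₁ : List ((chamberGraph 𝒜).E × Bool)).length = J.card ∧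
      ((⟨(A, Bj), hBj⟩, true) :: l₂ : List ((chamberGraph 𝒜).E × Bool)).length = J.card ∧
      (∀ H ∈ 𝒜, (sg f E.1 H ↔ sg f A.1 H ∧ H ∉ J)) ∧
      (∀ H ∈ 𝒜, (sg f Bi.1 H ↔ sg f A.1 H ∧ H ≠ i)) ∧
      (∀ H ∈ 𝒜, (sg f Bj.1 H ↔ sg f A.1 H ∧ H ≠ j)) ∧
      RR R A ((⟨(A, Bi), hBi⟩, true) :: l₁) ((⟨(A, Bj), hBj⟩, true) :: l₂) := by
  have hgal : ∀ (μ : ℝ), μ ≠ 0 → _ := fun μ hμ => by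
    have hlow : ∃ a, ∀ K ∈ J, a < μ * σ K := by
      have : ∀ᶠ a in Filter.atBot, ∀ K ∈ J, a < μ * σ K := by
        rw [Filter.eventually_all_finset]
        intro K _
        exact Filter.eventually_lt_atBot _
      exact this.exists
    exact gallery hf (fun K => μ * σ K) _ J rfl hJ𝒜 A hA
      (fun x hx y hy h => hσ hx hy (mul_left_cancel₀ hμ h)) hlow.choose
      (fun c _ hne => realize hf z (c • v + μ • w) J hJ hJ𝒜 A hA hA' (fun K => μ * σ K) c (by
        intro K hK
        rw [map_add, map_smul, map_smul, hv K hK, hw K hK]; simp; ring) hne)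
      hlow.choose_spec
  obtain ⟨E, l₁, hl₁, hlen₁, hE, hvis₁, hfst₁⟩ := hgal (-1) (by norm_num)
  obtain ⟨E', l₂, hl₂, hlen₂, hE', hvis₂, hfst₂⟩ := hgal 1 (by norm_num)
  have hEE : E' = E := by
    apply Subtype.ext
    apply chamber_ext hf E'.2 E.2
    intro H hH
    rw [hE H hH, hE' H hH]
  subst hEE
  obtain ⟨Bi, hBi, l₁', rfl, hsBi⟩ := hfst₁ i hi (fun K hK => by have := hmax K hK; linarith)
  obtain ⟨Bj, hBj, l₂', rfl, hsBj⟩ := hfst₂ j hj (fun K hK => by have := hmin K hK; linarith)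
  refine ⟨E', Bi, Bj, hBi, hBj, l₁', l₂', hl₁, hl₂, hlen₁, hlen₂, hE, hsBi, hsBj, hl₁.1, hl₂.1, ?_⟩
  have hiz := (hJ i (hJ𝒜 hi)).1 hi
  have hjz := (hJ j (hJ𝒜 hj)).1 hj
  have hgt : ∀ C : (chamberGraph 𝒜).V, (∀ H ∈ 𝒜, H ∉ J → (sg f C.1 H ↔ sg f A.1 H)) →
      FaceGT (faceOf 𝒜 z) C.1 := by
    intro C hC
    apply face_gt hf z C _ ⟨i, hJ𝒜 hi, hiz⟩
    intro H hH h0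
    rw [hC H hH (fun h => h0 ((hJ H hH).1 h)), hA' H hH h0]
  have hzF : z ∈ faceOf 𝒜 z := (mem_face hf z z).2 (by simp)
  have hopp : OppChamber 𝒜 (faceOf 𝒜 z) A.1 E'.1 := by
    refine ⟨E'.2, hgt E' (fun H hH h => by rw [hE H hH]; simp [h]), ?_⟩
    intro H hH hsub
    have hzH : z ∈ H := hsub (subset_affineSpan ℝ _ hzF)
    have hHJ : H ∈ J := (hJ H hH).2 ((hf H hH z).1 hzH)
    rw [separates_iff hf A.2 E'.2 hH, hE H hH]
    have := hA H hHJ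
    tauto
  have hdst : dst A E' = J.card := by
    unfold dst
    congr 1
    ext H
    simp only [Finset.mem_filter]
    constructor
    · rintro ⟨hH, hs⟩
      rw [separates_iff hf A.2 E'.2 hH, hE H hH] at hs
      tauto
    · intro hH
      refine ⟨hJ𝒜 hH, ?_⟩
      rw [separates_iff hf A.2 E'.2 (hJ𝒜 hH), hE H (hJ𝒜 hH)]
      have := hA H hH
      tauto
  have hend₁ : (GWalk.mk A _ hl₁.1).endV = E' := hl₁.2.2
  have hend₂ : (GWalk.mk A _ hl₂.1).endV = E' := hl₂.2.2
  apply hR (faceOf 𝒜 z) ⟨z, rfl⟩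
  · apply face_dim hf z v w (hJ𝒜 hi) (hJ𝒜 hj) hiz hjz
      (fun k hk hkz => hr k ((hJ k hk).2 hkz))
    rw [hv i hi, hv j hj, hw i hi, hw j hj]
    intro h
    exact hij (hσ hi hj (by linarith))
  · exact hgt A (fun _ _ _ => Iff.rfl)
  · rw [minpos_iff h𝒜, hend₁]
    exact ⟨hl₁.2.1, hlen₁.trans hdst.symm⟩
  · rw [minpos_iff h𝒜, hend₂]
    exact ⟨hl₂.2.1, hlen₂.trans hdst.symm⟩
  · intro u hu
    exact hgt u (hvis₁ u hu)
  · intro u hu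
    exact hgt u (hvis₂ u hu)
  · rw [hend₁]; exact hopp
  · rw [hend₂]; exact hopp
  · rfl
  · rw [hend₁, hend₂]

end
end Geo

namespace Geo
section
variable {d : ℕ} {𝒜 : Finset (Set (Fin d → ℝ))}
  {f : Set (Fin d → ℝ) → ((Fin d → ℝ) →ᵃ[ℝ] ℝ)}

theorem first_cross (hf : Rep 𝒜 f) (A B₁ B : (chamberGraph 𝒜).V) (hB : ∀ H ∈ 𝒜, ¬ sg f B.1 H)
    (hadj : Adjacent 𝒜 A.1 B₁.1) (hd : dst B₁ B < dst A B) :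
    ∃ i ∈ 𝒜, sg f A.1 i ∧ ∀ H ∈ 𝒜, (sg f B₁.1 H ↔ sg f A.1 H ∧ H ≠ i) := by
  obtain ⟨i, ⟨hi, hs⟩, huniq⟩ := hadj
  rw [separates_iff hf A.2 B₁.2 hi] at hs
  have hoth : ∀ H ∈ 𝒜, H ≠ i → (sg f B₁.1 H ↔ sg f A.1 H) := by
    intro H hH hne
    by_contra hcon
    exact hne (huniq H ⟨hH, (separates_iff hf A.2 B₁.2 hH).2 (by tauto)⟩)
  rw [dst_of_neg hf _ B hB, dst_of_neg hf _ B hB] at hd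
  have hAi : sg f A.1 i := by
    by_contra hAi
    refine absurd (Finset.card_le_card ?_) hd.not_ge
    intro H hH
    obtain ⟨hH, h⟩ := Finset.mem_filter.1 hH
    refine Finset.mem_filter.2 ⟨hH, ?_⟩
    by_cases hHi : H = i
    · subst hHi; exact absurd h hAi
    · exact (hoth H hH hHi).2 h
  refine ⟨i, hi, hAi, fun H hH => ?_⟩
  by_cases hHi : H = i
  · subst hHi; tauto
  · rw [hoth H hH hHi]; simp [hHi]

theorem wall_open (hf : Rep 𝒜 f) (A B₁ : (chamberGraph 𝒜).V) {i : Set (Fin d → ℝ)} (hi : i ∈ 𝒜)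
    (hAi : sg f A.1 i) (h : ∀ H ∈ 𝒜, (sg f B₁.1 H ↔ sg f A.1 H ∧ H ≠ i)) :
    IsOpen {p | p ∈ A.1 ∧ ∀ K ∈ 𝒜, sg f A.1 K → K ≠ i → f i p < f K p} ∧
    {p | p ∈ A.1 ∧ ∀ K ∈ 𝒜, sg f A.1 K → K ≠ i → f i p < f K p}.Nonempty := by
  constructor
  · have : {p | p ∈ A.1 ∧ ∀ K ∈ 𝒜, sg f A.1 K → K ≠ i → f i p < f K p} =
        A.1 ∩ ⋂ K ∈ 𝒜.filter (fun K => sg f A.1 K ∧ K ≠ i), {p | f i p < f K p} := by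
      ext p; simp
    rw [this]
    exact (chamber_open hf A.2).inter (isOpen_biInter_finset fun K _ =>
      isOpen_lt (aff_cont _) (aff_cont _))
  · obtain ⟨a, ha⟩ := chamber_nonempty A.2
    obtain ⟨b, hb⟩ := chamber_nonempty B₁.2
    have ha' := (mem_chamber hf A.2 a).1 ha
    have hb' := (mem_chamber hf B₁.2 b).1 hb
    have hai : 0 < f i a := (ha' i hi).2.2 hAi
    have hbi : f i b < 0 := by
      refine lt_of_le_of_ne (not_lt.1 fun h1 => ?_) (hb' i hi).1
      have := (hb' i hi).2.1 h1
      rw [h i hi] at this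
      exact this.2 rfl
    set s := f i a / (f i a - f i b) with hs
    have hpos : 0 < f i a - f i b := by linarith
    have hs0 : 0 < s := div_pos hai hpos
    have hs1 : s < 1 := by rw [hs, div_lt_one hpos]; linarith
    have hval : ∀ K, f K (a + s • (b - a)) = (1 - s) * f K a + s * f K b := by
      intro K
      rw [aff_add, map_smul, aff_sub]; simp; ring
    set w := a + s • (b - a) with hw
    have hwi : f i w = 0 := by
      rw [hval, hs]; field_simp; ring
    have hwK : ∀ K ∈ 𝒜, K ≠ i → f K w ≠ 0 ∧ (0 < f K w ↔ sg f A.1 K) := by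
      intro K hK hKi
      have h1 := ha' K hK
      have h2 := hb' K hK
      rw [h K hK] at h2
      rw [hval]
      by_cases hsK : sg f A.1 K
      · have h3 := h1.2.2 hsK
        have h4 := h2.2.2 ⟨hsK, hKi⟩
        have : 0 < (1 - s) * f K a + s * f K b :=
          add_pos (mul_pos (by linarith) h3) (mul_pos hs0 h4)
        exact ⟨this.ne', by simp [this, hsK]⟩
      · have h3 : f K a < 0 := lt_of_le_of_ne (not_lt.1 (fun hh => hsK (h1.2.1 hh))) h1.1
        have h4 : f K b < 0 := lt_of_le_of_ne (not_lt.1 (fun hh => hsK (h2.2.1 hh).1)) h2.1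
        have : (1 - s) * f K a + s * f K b < 0 :=
          add_neg (mul_neg_of_pos_of_neg (by linarith) h3) (mul_neg_of_pos_of_neg hs0 h4)
        exact ⟨this.ne, by simp [this.le, hsK]⟩
    have hev : ∀ᶠ ε : ℝ in nhdsWithin 0 (Set.Ioi 0), ∀ K ∈ 𝒜, sg f A.1 K → K ≠ i →
        f i (w + ε • (a - w)) < f K (w + ε • (a - w)) := by
      rw [Filter.eventually_all_finset]
      intro K hK
      by_cases hc : sg f A.1 K ∧ K ≠ i
      · have h1 : f i w < f K w := by rw [hwi]; exact (hwK K hK hc.2).2.2 hc.1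
        filter_upwards [(aff_tendsto (f i) w (a - w)).eventually_lt (aff_tendsto (f K) w (a - w)) h1]
          with ε hε _ _ using hε
      · filter_upwards with ε h1 h2 using absurd ⟨h1, h2⟩ hc
    obtain ⟨ε, ⟨h1, h2⟩, h3⟩ := ((hev.and (small_sign (𝒜 := 𝒜) (f := f) w (a - w))).and
      self_mem_nhdsWithin).exists
    have hε : (0:ℝ) < ε := h3
    refine ⟨w + ε • (a - w), ?_, h1⟩
    rw [mem_chamber hf A.2]
    intro K hK
    by_cases hKi : K = i
    · subst hKi
      have : f K (w + ε • (a - w)) = ε * f K a := by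
        rw [aff_add, map_smul, aff_sub, hwi]; simp
      rw [this]
      have := mul_pos hε hai
      exact ⟨this.ne', by simp [this, hAi]⟩
    · have h4 := hwK K hK hKi
      have h5 := h2 K hK h4.1
      exact ⟨h5.1, h5.2.trans h4.2⟩

theorem main (h𝒜 : IsArrangement 𝒜) {R : OrientedSystem (chamberGraph 𝒜)} (hR : FlipHyp R) :
    ∀ (n : ℕ) (A B : (chamberGraph 𝒜).V) (l₁ l₂ : List ((chamberGraph 𝒜).E × Bool)),
      dst A B = n → PW A B l₁ → PW A B l₂ → l₁.length = n → l₂.length = n → RR R A l₁ l₂ := by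
  intro n
  induction n with
  | zero =>
    intro A B l₁ l₂ _ h1 h2 h3 h4
    have e1 := List.length_eq_zero_iff.1 h3
    have e2 := List.length_eq_zero_iff.1 h4
    subst e1 e2
    exact ⟨h1.1, h1.1, R.rel_refl _⟩
  | succ n IH =>
    intro A B l₁ l₂ hd h1 h2 hlen1 hlen2
    obtain ⟨q, f, hqB, hf, hq⟩ := exists_rep' h𝒜 B
    have hBneg := neg_of_q hf hq B hqB
    -- the first step
    have hstep : ∀ (B₁ : (chamberGraph 𝒜).V) (hadj : Adjacent 𝒜 A.1 B₁.1) l, PW B₁ B l → l.length = n →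
        dst B₁ B = n := by
      intro B₁ hadj l hl hlen
      have h3 := dst_le_length hf _ _ _ hl
      have h4 := dst_triangle hf A B₁ B
      rw [dst_adj hadj] at h4
      omega
    -- two galleries with the same first wall
    have hsame : ∀ (B₁ B₂ : (chamberGraph 𝒜).V) (hadj₁ : Adjacent 𝒜 A.1 B₁.1)
        (hadj₂ : Adjacent 𝒜 A.1 B₂.1) (l l' : List ((chamberGraph 𝒜).E × Bool))
        (i : Set (Fin d → ℝ)), PW B₁ B l → PW B₂ B l' → l.length = n → l'.length = n →
        (∀ H ∈ 𝒜, (sg f B₁.1 H ↔ sg f A.1 H ∧ H ≠ i)) →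
        (∀ H ∈ 𝒜, (sg f B₂.1 H ↔ sg f A.1 H ∧ H ≠ i)) →
        RR R A ((⟨(A, B₁), hadj₁⟩, true) :: l) ((⟨(A, B₂), hadj₂⟩, true) :: l') := by
      intro B₁ B₂ hadj₁ hadj₂ l l' i hl hl' hn hn' hs hs'
      have : B₁ = B₂ := by
        apply Subtype.ext
        apply chamber_ext hf B₁.2 B₂.2
        intro H hH
        rw [hs H hH, hs' H hH]
      subst this
      have h3 := IH B₁ B l l' (hstep B₁ hadj₁ l hl hn) hl hl' hn hn'
      have h4 : PW A B₁ [(⟨(A, B₁), hadj₁⟩, true)] :=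
        PW.cons hadj₁ ⟨trivial, by simp, rfl⟩
      have := h3.comp h4 hl (n := []) trivial
      simpa using this
    obtain ⟨s₁, l₁', rfl⟩ := List.exists_cons_of_length_eq_add_one hlen1
    obtain ⟨s₂, l₂', rfl⟩ := List.exists_cons_of_length_eq_add_one hlen2
    simp only [List.length_cons, Nat.add_right_cancel_iff] at hlen1 hlen2
    obtain ⟨B₁, hadj₁, rfl, hl₁⟩ := h1.uncons
    obtain ⟨B₂, hadj₂, rfl, hl₂⟩ := h2.uncons
    obtain ⟨i₁, hi₁, hAi₁, hsB₁⟩ := first_cross hf A B₁ B hBneg hadj₁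
      (by rw [hstep B₁ hadj₁ _ hl₁ hlen1]; omega)
    obtain ⟨i₂, hi₂, hAi₂, hsB₂⟩ := first_cross hf A B₂ B hBneg hadj₂
      (by rw [hstep B₂ hadj₂ _ hl₂ hlen2]; omega)
    -- generic points
    obtain ⟨hU₁, hU₁ne⟩ := wall_open hf A B₁ hi₁ hAi₁ hsB₁
    obtain ⟨hU₂, hU₂ne⟩ := wall_open hf A B₂ hi₂ hAi₂ hsB₂
    obtain ⟨p, ⟨hpA, hp₁⟩, hgen⟩ := exists_generic ((𝒜 ×ˢ 𝒜).filter (fun x => x.1 ≠ x.2))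
      (fun x : Set (Fin d → ℝ) × Set (Fin d → ℝ) => f x.1 - f x.2)
      (by
        rintro ⟨H, K⟩ h
        simp only [Finset.mem_filter, Finset.mem_product] at h
        exact sub_ne hf h.1.1 h.1.2 h.2) hU₁ hU₁ne
    have hpne : ∀ H ∈ 𝒜, ∀ K ∈ 𝒜, f H p = f K p → H = K := by
      intro H hH K hK h
      by_contra hne
      apply hgen (H, K) (by simp [hH, hK, hne])
      simp [h]
    let G : Set (Fin d → ℝ) × Set (Fin d → ℝ) × Set (Fin d → ℝ) → ((Fin d → ℝ) →ᵃ[ℝ] ℝ) :=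
      fun x => (f x.2.1 p - f x.1 p) • (f x.2.2 - f x.1) - (f x.2.2 p - f x.1 p) • (f x.2.1 - f x.1)
    obtain ⟨p', ⟨hpA', hp₂⟩, hgen'⟩ := exists_generic
      ((𝒜 ×ˢ 𝒜 ×ˢ 𝒜).filter (fun x => ∃ y, G x y ≠ 0)) G
      (by
        intro x hx
        exact (Finset.mem_filter.1 hx).2) hU₂ hU₂ne
    have hG : ∀ i ∈ 𝒜, ∀ j ∈ 𝒜, ∀ k ∈ 𝒜,
        (f j p - f i p) * (f k p' - f i p') = (f k p - f i p) * (f j p' - f i p') →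
        ∀ x, (f j p - f i p) * (f k x - f i x) = (f k p - f i p) * (f j x - f i x) := by
      intro i hi j hj k hk h x
      by_contra hne
      apply hgen' (i, j, k)
      · simp only [Finset.mem_filter, Finset.mem_product]
        refine ⟨⟨hi, hj, hk⟩, x, ?_⟩
        simpa [G, sub_eq_zero] using hne
      · simpa [G, sub_eq_zero] using h
    have hpA1 := (mem_chamber hf A.2 p).1 hpA
    have hpA1' := (mem_chamber hf A.2 p').1 hpA'
    set S := 𝒜.filter (fun H => sg f A.1 H) with hS
    have hS𝒜 : S ⊆ 𝒜 := Finset.filter_subset _ _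
    have hSsg : ∀ K ∈ S, sg f A.1 K := fun K hK => (Finset.mem_filter.1 hK).2
    have hdA : S.card = n + 1 := by rw [← hd, dst_of_neg hf A B hBneg]
    let σ : Set (Fin d → ℝ) → ℝ := fun K => f K p' - f K p
    let g : Set (Fin d → ℝ) → ℝ → ℝ := fun K t => f K p + t * σ K
    have hgval : ∀ K t, f K (p + t • (p' - p)) = g K t := by
      intro K t
      rw [aff_add, map_smul, aff_sub]; simp [g, σ]
    have hi₂S : i₂ ∈ S := by simp [hS, hi₂, hAi₂]
    have hi₁S : i₁ ∈ S := by simp [hS, hi₁, hAi₁]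
    have inner : ∀ (N : ℕ) (i : Set (Fin d → ℝ)) (t : ℝ), i ∈ S → 0 ≤ t → t ≤ 1 →
        (∀ k ∈ S, g i t ≤ g k t ∧ (g i t = g k t → σ i ≤ σ k)) →
        (S.filter (fun k => σ k < σ i)).card ≤ N →
        ∀ (Bi : (chamberGraph 𝒜).V) (hadj : Adjacent 𝒜 A.1 Bi.1)
          (l : List ((chamberGraph 𝒜).E × Bool)), PW Bi B l → l.length = n →
          (∀ H ∈ 𝒜, (sg f Bi.1 H ↔ sg f A.1 H ∧ H ≠ i)) →
          RR R A ((⟨(A, Bi), hadj⟩, true) :: l) ((⟨(A, B₂), hadj₂⟩, true) :: l₂') := by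
      intro N
      induction N with
      | zero =>
        intro i t hi ht0 ht1 hinv hN Bi hadj l hl hlen hsBi
        by_cases hii : i = i₂
        · subst hii
          exact hsame _ _ _ _ _ _ i hl hl₂ hlen hlen2 hsBi hsB₂
        · exfalso
          have h3 : g i₂ 1 < g i 1 := by
            have := hp₂ i (hS𝒜 hi) (hSsg i hi) hii
            simp only [g, σ]; linarith
          have h4 := (hinv i₂ hi₂S).1
          have h5 : σ i₂ < σ i := by
            simp only [g] at h3 h4
            by_contra h6
            push Not at h6
            nlinarith
          have : i₂ ∈ S.filter (fun k => σ k < σ i) := Finset.mem_filter.2 ⟨hi₂S, h5⟩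
          have := Finset.card_pos.2 ⟨_, this⟩
          omega
      | succ N ihN =>
        intro i t hi ht0 ht1 hinv hN Bi hadj l hl hlen hsBi
        by_cases hii : i = i₂
        · subst hii
          exact hsame _ _ _ _ _ _ i hl hl₂ hlen hlen2 hsBi hsB₂
        have h3 : g i₂ 1 < g i 1 := by
          have := hp₂ i (hS𝒜 hi) (hSsg i hi) hii
          simp only [g, σ]; linarith
        have h4 := (hinv i₂ hi₂S).1
        have h5 : σ i₂ < σ i := by
          simp only [g] at h3 h4
          by_contra h6
          push Not at h6
          nlinarith
        let T : Set (Fin d → ℝ) → ℝ := fun k => (f k p - f i p) / (σ i - σ k)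
        have hT : ∀ k, σ k < σ i → ∀ t', (t' ≤ T k ↔ g i t' ≤ g k t') := by
          intro k hk t'
          have : 0 < σ i - σ k := by linarith
          simp only [T, g]
          rw [le_div_iff₀ this]
          constructor <;> intro h <;> linarith
        have hT' : ∀ k, σ k < σ i → g i (T k) = g k (T k) := by
          intro k hk
          have : σ i - σ k ≠ 0 := by intro h; linarith
          simp only [T, g]
          field_simp
          ring
        obtain ⟨k₀, hk₀, hk₀min⟩ := (S.filter (fun k => σ k < σ i)).exists_min_image T
          ⟨i₂, Finset.mem_filter.2 ⟨hi₂S, h5⟩⟩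
        obtain ⟨hk₀S, hk₀σ⟩ := Finset.mem_filter.1 hk₀
        set t₀ := T k₀ with ht₀
        have htt₀ : t ≤ t₀ := (hT k₀ hk₀σ t).2 (hinv k₀ hk₀S).1
        have htt₀' : t < t₀ := by
          refine lt_of_le_of_ne htt₀ fun h => ?_
          have := (hinv k₀ hk₀S).2 (by rw [h]; exact hT' k₀ hk₀σ)
          linarith
        have ht₀1 : t₀ ≤ 1 := by
          refine le_trans (hk₀min i₂ (Finset.mem_filter.2 ⟨hi₂S, h5⟩)) ?_
          by_contra h6
          push Not at h6
          have := (hT i₂ h5 1).1 h6.le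
          linarith
        have hmin₀ : ∀ k ∈ S, g i t₀ ≤ g k t₀ := by
          intro k hk
          by_cases hkσ : σ k < σ i
          · exact (hT k hkσ t₀).1 (hk₀min k (Finset.mem_filter.2 ⟨hk, hkσ⟩))
          · push Not at hkσ
            have := (hinv k hk).1
            simp only [g] at this ⊢
            nlinarith
        set J := S.filter (fun k => g k t₀ = g i t₀) with hJ
        have hJS : J ⊆ S := Finset.filter_subset _ _
        have hiJ : i ∈ J := by simp [hJ, hi]
        have hk₀J : k₀ ∈ J := Finset.mem_filter.2 ⟨hk₀S, (hT' k₀ hk₀σ).symm⟩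
        have hJval : ∀ k ∈ J, g k t₀ = g i t₀ := fun k hk => (Finset.mem_filter.1 hk).2
        have hmaxJ : ∀ k ∈ J, σ k ≤ σ i := by
          intro k hk
          by_contra h6
          push Not at h6
          have h7 := hJval k hk
          have h8 := (hinv k (hJS hk)).1
          simp only [g] at h7 h8
          nlinarith
        obtain ⟨j, hjJ, hjmin⟩ := J.exists_min_image σ ⟨i, hiJ⟩
        have hjσ : σ j < σ i := lt_of_le_of_lt (hjmin k₀ hk₀J) hk₀σ
        have hij : i ≠ j := fun h => by subst h; exact lt_irrefl _ hjσ
        have hσinj : Set.InjOn σ J := by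
          intro x hx y hy hxy
          apply hpne x (hS𝒜 (hJS hx)) y (hS𝒜 (hJS hy))
          have h6 := hJval x hx
          have h7 := hJval y hy
          simp only [g] at h6 h7
          rw [hxy] at h6
          linarith
        -- the point of the codimension two face
        set m := g i t₀ with hm
        set P := p + t₀ • (p' - p) with hP
        have hPval : ∀ K, f K P = (1 - t₀) * f K p + t₀ * f K p' := by
          intro K; rw [hP, hgval]; simp only [g, σ]; ring
        have ht₀0 : 0 ≤ t₀ := le_trans ht0 htt₀
        have hPpos : ∀ K ∈ 𝒜, sg f A.1 K → 0 < f K P := by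
          intro K hK hs
          have h6 := (hpA1 K hK).2.2 hs
          have h7 := (hpA1' K hK).2.2 hs
          rw [hPval]
          nlinarith
        have hPneg : ∀ K ∈ 𝒜, ¬ sg f A.1 K → f K P < 0 := by
          intro K hK hs
          have h6 : f K p < 0 :=
            lt_of_le_of_ne (not_lt.1 (fun hh => hs ((hpA1 K hK).2.1 hh))) (hpA1 K hK).1
          have h7 : f K p' < 0 :=
            lt_of_le_of_ne (not_lt.1 (fun hh => hs ((hpA1' K hK).2.1 hh))) (hpA1' K hK).1
          rw [hPval]
          nlinarith
        have hm0 : 0 < m := by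
          rw [hm, ← hgval]; exact hPpos i (hS𝒜 hi) (hSsg i hi)
        have h1m : 0 < 1 + m := by linarith
        set z := q + (1 + m)⁻¹ • (P - q) with hz
        have hzval : ∀ K ∈ 𝒜, f K z = (f K P - m) / (1 + m) := by
          intro K hK
          rw [hz, aff_add, map_smul, aff_sub, hq K hK]
          simp only [smul_eq_mul]
          field_simp
          ring
        have hzJ : ∀ H ∈ 𝒜, (H ∈ J ↔ f H z = 0) := by
          intro H hH
          rw [hzval H hH, div_eq_zero_iff, sub_eq_zero]
          simp only [h1m.ne', or_false]
          constructor
          · intro h; rw [hP, hgval]; exact hJval H h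
          · intro h
            by_cases hs : sg f A.1 H
            · refine Finset.mem_filter.2 ⟨Finset.mem_filter.2 ⟨hH, hs⟩, ?_⟩
              rw [← hgval]; exact h
            · have := hPneg H hH hs; linarith
        have hzA : ∀ H ∈ 𝒜, f H z ≠ 0 → (sg f A.1 H ↔ 0 < f H z) := by
          intro H hH h0
          have h0' : f H P ≠ m := by
            intro h; apply h0; rw [hzval H hH, h]; simp
          rw [hzval H hH, div_pos_iff_of_pos_right h1m, sub_pos]
          constructor
          · intro hs
            have := hmin₀ H (Finset.mem_filter.2 ⟨hH, hs⟩)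
            rw [← hgval] at this
            exact lt_of_le_of_ne this h0'.symm
          · intro h
            by_contra hs
            have := hPneg H hH hs; linarith
        have hrank : ∀ k ∈ J, ∀ x, f i x = 0 → f j x = 0 → f k x = 0 := by
          intro k hk x hix hjx
          have hi𝒜 := hS𝒜 (hJS hiJ)
          have hj𝒜 := hS𝒜 (hJS hjJ)
          have hk𝒜 := hS𝒜 (hJS hk)
          have h6 := hJval k hk
          have h7 := hJval j hjJ
          have ht₀pos : 0 < t₀ := lt_of_le_of_lt ht0 htt₀'
          have h8 := hG i hi𝒜 j hj𝒜 k hk𝒜 (by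
            simp only [g, σ] at h6 h7
            have e1 : t₀ * (f k p' - f i p') = -(1 - t₀) * (f k p - f i p) := by linarith
            have e2 : t₀ * (f j p' - f i p') = -(1 - t₀) * (f j p - f i p) := by linarith
            apply mul_left_cancel₀ ht₀pos.ne'
            linear_combination (f j p - f i p) * e1 - (f k p - f i p) * e2) x
          rw [hix, hjx] at h8
          have h9 : f j p - f i p ≠ 0 := fun h => hij (hpne i hi𝒜 j hj𝒜 (by linarith))
          have : (f j p - f i p) * f k x = 0 := by linarith
          exact (mul_eq_zero.1 this).resolve_left h9
        obtain ⟨E, Ci, Cj, hCi, hCj, m₁, m₂, hm₁, hm₂, hml₁, hml₂, hE, hsCi, hsCj, hRR⟩ :=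
          flip h𝒜 hf hR A z (q - z) (p' - p) J hzJ (hJS.trans hS𝒜) (fun K hK => hSsg K (hJS hK))
          hzA σ hσinj (fun K hK => by
            rw [aff_sub, hq K (hS𝒜 (hJS hK)), (hzJ K (hS𝒜 (hJS hK))).1 hK]; simp)
          (fun K hK => by rw [aff_sub]) hiJ hjJ hij hmaxJ hjmin hrank
        obtain ⟨γ, hγ, hγlen⟩ := exists_gallery h𝒜 E B
        have hcard : J.card + γ.length = n + 1 := by
          rw [hγlen, dst_of_neg hf E B hBneg, ← hdA]
          have : 𝒜.filter (fun H => sg f E.1 H) = S \ J := by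
            ext H
            simp only [Finset.mem_filter, Finset.mem_sdiff, hS]
            constructor
            · rintro ⟨hH, h⟩
              rw [hE H hH] at h
              exact ⟨⟨hH, h.1⟩, h.2⟩
            · rintro ⟨⟨hH, h⟩, h'⟩
              exact ⟨hH, (hE H hH).2 ⟨h, h'⟩⟩
          rw [this, Finset.card_sdiff_of_subset hJS]
          have := Finset.card_le_card hJS
          omega
        have hRR2 := hRR.comp (A := A) (m := []) (n := γ) ⟨trivial, by simp, rfl⟩ hm₁ hγ.1
        simp only [List.nil_append, List.cons_append] at hRR2
        have q₁ := hm₁.append hγ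
        have q₂ := hm₂.append hγ
        simp only [List.length_cons] at hml₁ hml₂
        have tail : ∀ (C : (chamberGraph 𝒜).V) (hC : Adjacent 𝒜 A.1 C.1) (l : List ((chamberGraph 𝒜).E × Bool)),
            PW A B ((⟨(A, C), hC⟩, true) :: l) → PW C B l := by
          intro C hC l h
          exact ⟨h.1.2, fun s hs => h.2.1 s (by simp [hs]), h.2.2⟩
        have r₁ := tail _ _ _ q₁
        have r₂ := tail _ _ _ q₂
        refine (hsame Bi Ci hadj hCi l (m₁ ++ γ) i hl r₁ hlen
          (by rw [List.length_append]; omega) hsBi hsCi).trans (hRR2.trans ?_)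
        refine ihN j t₀ (hJS hjJ) ht₀0 ht₀1 ?_ ?_ Cj hCj (m₂ ++ γ) r₂
          (by rw [List.length_append]; omega) hsCj
        · intro k hk
          rw [hJval j hjJ]
          refine ⟨hmin₀ k hk, fun h => hjmin k (Finset.mem_filter.2 ⟨hk, h.symm⟩)⟩
        · have : S.filter (fun k => σ k < σ j) ⊂ S.filter (fun k => σ k < σ i) := by
            rw [Finset.ssubset_iff_of_subset]
            · exact ⟨j, Finset.mem_filter.2 ⟨hJS hjJ, hjσ⟩, by simp⟩
            · intro k hk
              obtain ⟨h6, h7⟩ := Finset.mem_filter.1 hk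
              exact Finset.mem_filter.2 ⟨h6, h7.trans hjσ⟩
          have := Finset.card_lt_card this
          omega
    refine inner _ i₁ 0 hi₁S le_rfl zero_le_one ?_ le_rfl B₁ hadj₁ l₁' hl₁ hlen1 hsB₁
    intro k hk
    by_cases hki : k = i₁
    · subst hki; exact ⟨le_rfl, fun _ => le_rfl⟩
    · have := hp₁ k (hS𝒜 hk) (hSsg k hk) hki
      simp only [g, zero_mul, add_zero]
      exact ⟨this.le, fun h => absurd h this.ne⟩

theorem minpos_rel (h𝒜 : IsArrangement 𝒜) {R : OrientedSystem (chamberGraph 𝒜)} (hR : FlipHyp R)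
    (α β : GWalk (chamberGraph 𝒜)) (hs : α.start = β.start) (he : α.endV = β.endV)
    (hα : IsMinPos _ α) (hβ : IsMinPos _ β) : R.rel α β := by
  rw [minpos_iff h𝒜] at hα hβ
  obtain ⟨a, l, hl⟩ := α
  obtain ⟨b, l', hl'⟩ := β
  have hab : a = b := hs
  subst hab
  have h2 := hβ.2
  rw [← he] at h2
  obtain ⟨_, _, h⟩ := main h𝒜 hR _ a _ l l' rfl ⟨hl, hα.1, rfl⟩ ⟨hl', hβ.1, he.symm⟩ hα.2 h2
  exact h

end
end Geo

namespace Top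

theorem abs1 {C : Type*} [Groupoid C] {X A B D : C} (d1 : X ⟶ A) (m : A ⟶ B) (d2 : X ⟶ B)
    (w : B ⟶ D) (d3 : X ⟶ D) (h : A = A) :
    d1 ≫ (eqToHom h ≫ m ≫ w) ≫ Groupoid.inv d3 =
      (d1 ≫ m ≫ Groupoid.inv d2) ≫ (d2 ≫ w ≫ Groupoid.inv d3) := by
  simp

theorem abs2 {C : Type*} [Groupoid C] {X S A' A B A2 B2 : C} (d : S ⟶ A') (g1 : A ⟶ B)
    (g2 : A2 ⟶ B2) (d3 : X ⟶ B) (h1 : X = S) (h2 : A' = A) (hB : B = B2) (hA : A = A2)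
    (hA' : A2 = A') (h1' : S = X) :
    (eqToHom h1 ≫ d ≫ eqToHom h2 ≫ g1 ≫ eqToHom hB ≫ Groupoid.inv g2 ≫ eqToHom hA' ≫
      Groupoid.inv d ≫ eqToHom h1') ≫
      (((eqToHom h1 ≫ d ≫ eqToHom h2) ≫ eqToHom hA) ≫ g2 ≫ Groupoid.inv (d3 ≫ eqToHom hB)) =
    (eqToHom h1 ≫ d ≫ eqToHom h2) ≫ g1 ≫ Groupoid.inv d3 := by
  subst h1 h2 hB hA
  simp
section
variable {G : OrientedGraph} {v₀ : G.V}

abbrev ob (G : OrientedGraph) (v : G.V) := (Quiver.FreeGroupoid.of (QV G)).obj v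

def dd (δ : G.V → GWalk G) (hδ : ∀ u, (δ u).start = v₀ ∧ (δ u).endV = u) (u : G.V) :
    ob G v₀ ⟶ ob G u :=
  eqToHom (congrArg (Quiver.FreeGroupoid.of (QV G)).obj (hδ u).1.symm) ≫ (δ u).toHom ≫
    eqToHom (congrArg (Quiver.FreeGroupoid.of (QV G)).obj (hδ u).2)

variable (δ : G.V → GWalk G) (hδ : ∀ u, (δ u).start = v₀ ∧ (δ u).endV = u)

theorem dd_eq {a b : G.V} (h : a = b) :
    dd δ hδ a ≫ eqToHom (congrArg (Quiver.FreeGroupoid.of (QV G)).obj h) = dd δ hδ b := by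
  subst h; simp

def ps : G.E × Bool → Pi1 G v₀
  | (e, true) => dd δ hδ (G.src e) ≫
      (Quiver.FreeGroupoid.of (QV G)).map (X := G.src e) (Y := G.tgt e) ⟨e, rfl, rfl⟩ ≫
      Groupoid.inv (dd δ hδ (G.tgt e))
  | (e, false) => dd δ hδ (G.tgt e) ≫
      Groupoid.inv ((Quiver.FreeGroupoid.of (QV G)).map (X := G.src e) (Y := G.tgt e) ⟨e, rfl, rfl⟩) ≫
      Groupoid.inv (dd δ hδ (G.src e))

theorem ps_flip (s : G.E × Bool) : ps δ hδ (G.flipStep s) = (ps δ hδ s)⁻¹ := by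
  rw [eq_inv_iff_mul_eq_one]
  rcases s with ⟨e, _ | _⟩
  · show (_ ≫ _ ≫ _) ≫ (_ ≫ _ ≫ _) = 𝟙 _
    simp [dd]
  · show (_ ≫ _ ≫ _) ≫ (_ ≫ _ ≫ _) = 𝟙 _
    simp

def ph (l : List (G.E × Bool)) : Pi1 G v₀ := (l.map (ps δ hδ)).prod

theorem ph_append (l l' : List (G.E × Bool)) : ph δ hδ (l ++ l') = ph δ hδ l * ph δ hδ l' := by
  simp [ph]

theorem ph_inv (l : List (G.E × Bool)) : ph δ hδ (G.invList l) = (ph δ hδ l)⁻¹ := by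
  induction l with
  | nil => simp [ph, OrientedGraph.invList]
  | cons s l ih =>
    rw [G.invList_cons, ph_append, ih]
    simp [ph, ps_flip]

theorem ph_eq : ∀ (l : List (G.E × Bool)) (v : G.V) (h : G.WalkFrom v l),
    dd δ hδ v ≫ walkHom G v l h ≫ Groupoid.inv (dd δ hδ (G.walkEnd v l)) = ph δ hδ l
  | [], v, h => by
    show _ ≫ 𝟙 _ ≫ Groupoid.inv (dd δ hδ v) = 𝟙 _
    simp
  | (e, true) :: l, v, h => by
    obtain ⟨h1, h2⟩ := h
    subst h1
    have ih := ph_eq l _ h2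
    show _ = ps δ hδ (e, true) ≫ ph δ hδ l
    rw [← ih]
    exact abs1 _ _ _ _ _ _
  | (e, false) :: l, v, h => by
    obtain ⟨h1, h2⟩ := h
    subst h1
    have ih := ph_eq l _ h2
    show _ = ps δ hδ (e, false) ≫ ph δ hδ l
    rw [← ih]
    exact abs1 _ _ _ _ _ _

theorem loopClass_eq (γ₁ γ₂ : GWalk G) (hδs : (δ γ₁.start).start = v₀)
    (hδe : (δ γ₁.start).endV = γ₁.start) (hs : γ₁.start = γ₂.start) (he : γ₁.endV = γ₂.endV) :
    loopClass (δ γ₁.start) γ₁ γ₂ hδs hδe hs he = ph δ hδ γ₁.steps * (ph δ hδ γ₂.steps)⁻¹ := by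
  rw [eq_mul_inv_iff_mul_eq]
  rw [← ph_eq δ hδ γ₁.steps γ₁.start γ₁.valid, ← ph_eq δ hδ γ₂.steps γ₂.start γ₂.valid]
  show loopClass _ _ _ _ _ _ _ ≫ _ = _
  rw [← dd_eq δ hδ hs]
  have h2 : dd δ hδ (G.walkEnd γ₂.start γ₂.steps) = dd δ hδ (G.walkEnd γ₁.start γ₁.steps) ≫ eqToHom (congrArg (Quiver.FreeGroupoid.of (QV G)).obj he) := (dd_eq δ hδ he).symm
  rw [h2]
  exact abs2 _ _ _ _ _ _ _ _ _ _

end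
end Top

namespace Top
section

theorem gw_ext {G : OrientedGraph} {a b : GWalk G} (h1 : a.start = b.start)
    (h2 : a.steps = b.steps) : a = b := by
  cases a; cases b; cases h1; cases h2; rfl

theorem append_steps {G : OrientedGraph} {a b : GWalk G} (h : a.endV = b.start) :
    (a.append' b).steps = a.steps ++ b.steps := by
  simp [GWalk.append', h]

theorem append_start {G : OrientedGraph} (a b : GWalk G) :
    (a.append' b).start = a.start := by
  unfold GWalk.append'; split <;> rfl

theorem append_endV {G : OrientedGraph} {a b : GWalk G} (h : a.endV = b.start) :
    (a.append' b).endV = b.endV := by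
  unfold GWalk.endV
  rw [append_steps h, append_start, G.walkEnd_append]
  congr 1

theorem inv_endV {G : OrientedGraph} (a : GWalk G) : a.inv.endV = a.start :=
  G.walkEnd_inv _ _ a.valid

theorem invList_invList {G : OrientedGraph} (l : List (G.E × Bool)) :
    G.invList (G.invList l) = l := by
  have : G.flipStep ∘ G.flipStep = id := by funext s; simp [OrientedGraph.flipStep]
  simp [OrientedGraph.invList, List.map_reverse, this]

theorem inv_inv' {G : OrientedGraph} (a : GWalk G) : a.inv.inv = a :=
  gw_ext (inv_endV a) (invList_invList _)

variable {Θ Γ : OrientedGraph} (ρ : GraphMor Θ Γ)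

theorem map_inv (a : GWalk Θ) : ρ.mapWalk a.inv = (ρ.mapWalk a).inv := by
  refine gw_ext (ρ.mapWalk_endV a).symm ?_
  show (Θ.invList a.steps).map ρ.mapStep = Γ.invList (a.steps.map ρ.mapStep)
  simp [OrientedGraph.invList, List.map_reverse]
  exact fun a => ⟨fun _ => rfl, fun _ => rfl⟩

theorem map_append {a b : GWalk Θ} (h : a.endV = b.start) :
    ρ.mapWalk (a.append' b) = (ρ.mapWalk a).append' (ρ.mapWalk b) := by
  have h' : (ρ.mapWalk a).endV = (ρ.mapWalk b).start := by
    rw [ρ.mapWalk_endV, h]; rfl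
  refine gw_ext ?_ ?_
  · rw [append_start]; show ρ.onV _ = _; rw [append_start]; rfl
  · rw [append_steps h']; show List.map _ _ = _; rw [append_steps h, List.map_append]; rfl

def LE : Prop := ∀ (v : Θ.V) (α : GWalk Γ), α.start = ρ.onV v →
    ∃! α' : GWalk Θ, α'.start = v ∧ ρ.mapWalk α' = α

variable {ρ}

theorem LE.uniq (hL : LE ρ) {a b : GWalk Θ} (hs : a.start = b.start)
    (hm : ρ.mapWalk a = ρ.mapWalk b) : a = b :=
  (hL b.start (ρ.mapWalk b) rfl).unique ⟨hs, hm⟩ ⟨rfl, rfl⟩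

theorem LE.ex (hL : LE ρ) (v : Θ.V) (α : GWalk Γ) (h : α.start = ρ.onV v) :
    ∃ a : GWalk Θ, a.start = v ∧ ρ.mapWalk a = α := (hL v α h).exists

variable {v₀ : Θ.V} (δ : Θ.V → GWalk Θ) (hδ : ∀ u, (δ u).start = v₀ ∧ (δ u).endV = u)

def sys (hL : LE ρ) (N : Subgroup (Pi1 Θ v₀)) [N.Normal] : OrientedSystem Γ where
  rel α β := α.start = β.start ∧ α.endV = β.endV ∧ ∀ a b : GWalk Θ, a.start = b.start →
    ρ.mapWalk a = α → ρ.mapWalk b = β → a.endV = b.endV ∧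
      (ph δ hδ a.steps : Pi1 Θ v₀ ⧸ N) = ph δ hδ b.steps
  rel_start h := h.1
  rel_endV h := h.2.1
  rel_refl α := by
    refine ⟨rfl, rfl, fun a b hs ha hb => ?_⟩
    rw [hL.uniq hs (ha.trans hb.symm)]
    exact ⟨rfl, rfl⟩
  rel_symm h := ⟨h.1.symm, h.2.1.symm, fun a b hs ha hb =>
    ⟨(h.2.2 b a hs.symm hb ha).1.symm, (h.2.2 b a hs.symm hb ha).2.symm⟩⟩
  rel_trans {α β γ} h h' := by
    refine ⟨h.1.trans h'.1, h.2.1.trans h'.2.1, fun a c hs ha hc => ?_⟩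
    obtain ⟨b, hb1, hb2⟩ := hL.ex a.start β (by rw [← h.1, ← ha]; rfl)
    have h1 := h.2.2 a b hb1.symm ha hb2
    have h2 := h'.2.2 b c (hb1.trans hs) hb2 hc
    exact ⟨h1.1.trans h2.1, h1.2.trans h2.2⟩
  rel_cancel α := by
    have hst : α.endV = α.inv.start := rfl
    refine ⟨append_start _ _, (append_endV hst).trans (inv_endV α), fun a b hs ha hb => ?_⟩
    have hα : α.start = ρ.onV a.start := by
      rw [← append_start α α.inv, ← ha]; rfl
    obtain ⟨c, hc1, hc2⟩ := hL.ex a.start α hα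
    have e1 : a = c.append' c.inv := by
      refine hL.uniq (by rw [append_start, hc1]) ?_
      rw [ha, map_append ρ (rfl : c.endV = c.inv.start), map_inv, hc2]
    have e2 : b = GWalk.nil Θ a.start := by
      refine hL.uniq (by rw [← hs]; rfl) ?_
      rw [hb]
      exact gw_ext hα rfl
    have hcc : c.endV = c.inv.start := rfl
    subst e2
    rw [e1]
    refine ⟨?_, ?_⟩
    · rw [append_endV hcc, inv_endV, hc1, e1, append_start, hc1, e1, append_start]; rfl
    · rw [append_steps hcc, ph_append]
      show ((ph δ hδ c.steps * ph δ hδ (Θ.invList c.steps) : Pi1 Θ v₀) : Pi1 Θ v₀ ⧸ N) = _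
      rw [ph_inv, mul_inv_cancel]
      rfl
  rel_inv {α β} h := by
    refine ⟨h.2.1, by rw [inv_endV, inv_endV, h.1], fun a b hs ha hb => ?_⟩
    have ha' : ρ.mapWalk a.inv = α := by rw [map_inv, ha, inv_inv']
    have hb' : ρ.mapWalk b.inv = β := by rw [map_inv, hb, inv_inv']
    obtain ⟨c, hc1, hc2⟩ := hL.ex a.inv.start β (by rw [← h.1, ← ha']; rfl)
    have h1 := h.2.2 a.inv c hc1.symm ha' hc2
    have e : c.inv = b := by
      refine hL.uniq ?_ ?_
      · rw [← hs, ← inv_endV a, h1.1]; rfl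
      · rw [map_inv, hc2, hb]
    subst e
    refine ⟨?_, ?_⟩
    · rw [inv_endV, hc1]; rfl
    · have h2 := h1.2
      change ((ph δ hδ (Θ.invList a.steps) : Pi1 Θ v₀) : Pi1 Θ v₀ ⧸ N) = _ at h2
      change _ = ((ph δ hδ (Θ.invList c.steps) : Pi1 Θ v₀) : Pi1 Θ v₀ ⧸ N)
      rw [ph_inv] at h2 ⊢
      rw [QuotientGroup.mk_inv] at h2 ⊢
      rw [← h2, inv_inv]
  rel_comp {α β} g1 g2 h hg1 hg2 := by
    have hg1' : g1.endV = β.start := hg1.trans h.1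
    have hg2' : β.endV = g2.start := h.2.1.symm.trans hg2
    have hA : (g1.append' α).endV = g2.start := (append_endV hg1).trans hg2
    have hB : (g1.append' β).endV = g2.start := (append_endV hg1').trans hg2'
    refine ⟨by simp only [append_start], by rw [append_endV hA, append_endV hB],
      fun a b hs ha hb => ?_⟩
    have hst : g1.start = ρ.onV a.start := by
      rw [← append_start g1 α, ← append_start (g1.append' α) g2, ← ha]; rfl
    obtain ⟨c1, hc1, hc1'⟩ := hL.ex a.start g1 hst
    have hce : ρ.onV c1.endV = g1.endV := by rw [← ρ.mapWalk_endV, hc1']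
    obtain ⟨x, hx, hx'⟩ := hL.ex c1.endV α (by rw [hce, hg1])
    obtain ⟨y, hy, hy'⟩ := hL.ex c1.endV β (by rw [hce, hg1'])
    have hxe : ρ.onV x.endV = α.endV := by rw [← ρ.mapWalk_endV, hx']
    obtain ⟨c2, hc2, hc2'⟩ := hL.ex x.endV g2 (by rw [hxe, hg2])
    have h1 := h.2.2 x y (hx.trans hy.symm) hx' hy'
    have k1 : c1.endV = x.start := hx.symm
    have k1' : c1.endV = y.start := hy.symm
    have k2 : (c1.append' x).endV = c2.start := (append_endV k1).trans hc2.symm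
    have k2' : (c1.append' y).endV = c2.start :=
      ((append_endV k1').trans h1.1.symm).trans hc2.symm
    have e1 : a = (c1.append' x).append' c2 := by
      refine hL.uniq (by simp only [append_start, hc1]) ?_
      rw [ha, map_append ρ k2, map_append ρ k1, hc1', hx', hc2']
    have e2 : b = (c1.append' y).append' c2 := by
      refine hL.uniq (by simp only [append_start, hc1, hs]) ?_
      rw [hb, map_append ρ k2', map_append ρ k1', hc1', hy', hc2']
    rw [e1, e2]
    refine ⟨by rw [append_endV k2, append_endV k2'], ?_⟩
    rw [append_steps k2, append_steps k2', append_steps k1, append_steps k1']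
    simp only [ph_append, QuotientGroup.mk_mul, h1.2]

end
end Top


/-- The normal subgroup of `π₁(Θ)` generated by the classes of the loops
`β₁(F,v)·β₂(F,v)⁻¹` over all codimension-2 faces `F` and vertices `v` with `F > ρ(v)`
equals `Σ_ρ`, the normal subgroup generated by the classes of all loops `γ₁γ₂⁻¹` with
`ρ(γ₁) ∼ ρ(γ₂)`. -/
theorem statement_13 {d : ℕ} (𝒜 : Finset (Set (Fin d → ℝ))) (h𝒜 : IsArrangement 𝒜)
    {Θ : OrientedGraph} (SΓ : OrientedSystem (chamberGraph 𝒜))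
    (hSΓ : IsMinimalSystem (chamberGraph 𝒜) SΓ) (SΘ : OrientedSystem Θ)
    (ρ : GraphMor Θ (chamberGraph 𝒜)) (hcover : IsCoverOS ρ SΘ SΓ)
    (hrelΘ : ∀ γ₁ γ₂ : GWalk Θ, SΘ.rel γ₁ γ₂ ↔
      γ₁.start = γ₂.start ∧ SΓ.rel (ρ.mapWalk γ₁) (ρ.mapWalk γ₂))
    (hconn : GConnected Θ) (v₀ : Θ.V)
    (δ : Θ.V → GWalk Θ) (hδ : ∀ u, (δ u).start = v₀ ∧ (δ u).endV = u) :
    Subgroup.normalClosure (FlagLoopSet 𝒜 ρ v₀ δ) =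
      Subgroup.normalClosure (SigmaSet ρ SΓ v₀ δ) := by
  apply le_antisymm
  · apply Subgroup.normalClosure_mono
    rintro g ⟨F, hF, hr, γ₁, γ₂, h1, h2, h3, h4, h5, h6, h7, hδs, hδe, hs, he, rfl⟩
    refine ⟨γ₁, γ₂, hδs, hδe, hs, he, hSΓ.1 _ _ ?_ ?_ h2 h3, rfl⟩
    · exact congrArg ρ.onV hs
    · rw [ρ.mapWalk_endV, ρ.mapWalk_endV, he]
  · have hL : Top.LE ρ := hcover.lift_exists_unique
    let S' := Top.sys δ hδ hL (Subgroup.normalClosure (FlagLoopSet 𝒜 ρ v₀ δ))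
    have key : ∀ (a b : GWalk Θ) (hδs : (δ a.start).start = v₀)
        (hδe : (δ a.start).endV = a.start) (hs : a.start = b.start) (he : a.endV = b.endV),
        loopClass (δ a.start) a b hδs hδe hs he ∈
          Subgroup.normalClosure (FlagLoopSet 𝒜 ρ v₀ δ) ↔
        ((Top.ph δ hδ a.steps : Pi1 Θ v₀) :
          Pi1 Θ v₀ ⧸ Subgroup.normalClosure (FlagLoopSet 𝒜 ρ v₀ δ)) =
          (Top.ph δ hδ b.steps : Pi1 Θ v₀) := by
      intro a b hδs hδe hs he
      rw [Top.loopClass_eq δ hδ, ← div_eq_mul_inv, QuotientGroup.eq_iff_div_mem]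
    have hflip : Geo.FlipHyp S' := by
      intro F hF hr α β h1 h2 h3 h4 h5 h6 h7 hs he
      refine ⟨hs, he, fun a b hab ha hb => ?_⟩
      have hrel : SΓ.rel α β := hSΓ.1 _ _ hs he h2 h3
      have hr2 := hcover.lift_rel a.start α β (by rw [← ha]; rfl) (by rw [← hs, ← ha]; rfl)
        hrel a b rfl hab.symm ha hb
      have hee := SΘ.rel_endV hr2
      refine ⟨hee, (key a b (hδ _).1 (hδ _).2 hab hee).1 (Subgroup.subset_normalClosure ?_)⟩
      subst ha
      subst hb
      exact ⟨F, hF, hr, a, b, h1, h2, h3, h4, h5, h6, h7, _, _, _, _, rfl⟩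
    have hall := hSΓ.2 S' (fun α β hs he hα hβ => Geo.minpos_rel h𝒜 hflip α β hs he hα hβ)
    apply Subgroup.normalClosure_le_normal
    rintro g ⟨γ₁, γ₂, hδs, hδe, hs, he, hrel, rfl⟩
    exact (key γ₁ γ₂ hδs hδe hs he).2 ((hall _ _ hrel).2.2 γ₁ γ₂ hs rfl rfl).2

end
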